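/- Let p ≥ 5 be a prime and G a finite p-group. Then G is powerful (i.e., the commutator subgroup [G,G] is contained in the subgroup G^p generated by p-th powers) if and only if the minimal number of generators d(G) equals log_p of the order of Ω₁(G), the subgroup generated by all elements of order dividing p. -/

import Mathlib

/-- The subgroup generated by `n`-th powers of elements of `H`. -/
def powSubgroup {G : Type*} [Group G] (H : Subgroup G) (n : ℕ) : Subgroup G :=
  Subgroup.closure {x | ∃ h ∈ H, h ^ n = x}

universe u

section Powerful

open Subgroup

open scoped commutatorElement

section Collection

variable {G : Type*} [Group G]

/-- Collection of `(x * v) ^ n` when `⟨x, v⟩` has class at most three modulo the listed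
relations. -/
theorem mul_pow_collect {x v l z w : G} (hvx : v * x = x * (v * l)) (hlx : l * x = x * (l * z))
    (hlv : l * v = v * (l * w)) (hzx : Commute z x) (hzv : Commute z v) (hzl : Commute z l)
    (hwx : Commute w x) (hwv : Commute w v) (hwl : Commute w l) (hzw : Commute z w) (n : ℕ) :
    (x * v) ^ n = x ^ n * (v ^ n * (l ^ n.choose 2 *
      (z ^ n.choose 3 * w ^ (2 * n.choose 3 + n.choose 2)))) := by
  have hlx' (n : ℕ) : l ^ n * x = x * (l ^ n * z ^ n) := by
    induction n with
    | zero => simp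
    | succ n ih =>
      rw [pow_succ' l, mul_assoc, ih, ← mul_assoc, hlx, pow_succ' z]
      simp only [mul_assoc]
      rw [← mul_assoc z (l ^ n), (hzl.pow_right n).eq, mul_assoc]
  have hlv' (n : ℕ) : l ^ n * v = v * (l ^ n * w ^ n) := by
    induction n with
    | zero => simp
    | succ n ih =>
      rw [pow_succ' l, mul_assoc, ih, ← mul_assoc, hlv, pow_succ' w]
      simp only [mul_assoc]
      rw [← mul_assoc w (l ^ n), (hwl.pow_right n).eq, mul_assoc]
  have hlvn (n : ℕ) : l * v ^ n = v ^ n * (l * w ^ n) := by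
    induction n with
    | zero => simp
    | succ n ih =>
      rw [pow_succ v, ← mul_assoc, ih, mul_assoc, mul_assoc, (hwv.pow_left n).eq, ← mul_assoc l,
        hlv, pow_succ' w]
      simp only [mul_assoc]
  have hvx' (n : ℕ) : v ^ n * x = x * (v ^ n * (l ^ n * w ^ n.choose 2)) := by
    induction n with
    | zero => simp
    | succ n ih =>
      rw [pow_succ' v, mul_assoc, ih, ← mul_assoc, hvx]
      simp only [mul_assoc]
      rw [← mul_assoc l (v ^ n), hlvn]
      simp only [mul_assoc]
      rw [← mul_assoc (w ^ n) (l ^ n), (hwl.pow_pow n n).eq, Nat.choose_succ_succ' n 1,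
        Nat.choose_one_right, pow_add w, pow_succ' l n]
      simp only [mul_assoc]
  induction n with
  | zero => simp
  | succ n ih =>
    set a := n.choose 2
    set b := n.choose 3
    have hzxv : Commute (z ^ b * w ^ (2 * b + a)) (x * v) :=
      ((hzx.pow_left _).mul_left (hwx.pow_left _)).mul_right
        ((hzv.pow_left _).mul_left (hwv.pow_left _))
    have h2 : (n + 1).choose 2 = n + a := by
      rw [Nat.choose_succ_succ' n 1, Nat.choose_one_right]
    have h3 : (n + 1).choose 3 = a + b := Nat.choose_succ_succ' n 2
    rw [pow_succ, ih, h2, h3]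
    calc x ^ n * (v ^ n * (l ^ a * (z ^ b * w ^ (2 * b + a)))) * (x * v)
        = x ^ n * (v ^ n * (l ^ a * x * v)) * (z ^ b * w ^ (2 * b + a)) := by
          rw [mul_assoc (x ^ n), mul_assoc (v ^ n), mul_assoc (l ^ a), hzxv.eq]
          simp only [mul_assoc]
      _ = x ^ n * ((v ^ n * x) * (l ^ a * (z ^ a * v))) * (z ^ b * w ^ (2 * b + a)) := by
          rw [hlx']; simp only [mul_assoc]
      _ = x ^ (n + 1) * (v ^ n * (l ^ n * (w ^ a * (l ^ a * (v * z ^ a)))))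
            * (z ^ b * w ^ (2 * b + a)) := by
          rw [hvx', (hzv.pow_left a).eq, pow_succ x]; simp only [mul_assoc]; rfl
      _ = x ^ (n + 1) * (v ^ n * (l ^ (n + a) * v * (w ^ a * z ^ a)))
            * (z ^ b * w ^ (2 * b + a)) := by
          rw [← mul_assoc (w ^ a), (hwl.pow_pow a a).eq, mul_assoc (l ^ a), ← mul_assoc (w ^ a) v,
            (hwv.pow_left a).eq, pow_add l]
          simp only [mul_assoc]
      _ = x ^ (n + 1) * (v ^ (n + 1) * (l ^ (n + a) *
            ((w ^ (n + a) * w ^ a * z ^ a) * (z ^ b * w ^ (2 * b + a))))) := by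
          rw [hlv', pow_succ v]; simp only [mul_assoc]
      _ = _ := by
          congr 3
          have : 2 * (a + b) + (n + a) = (n + a + a) + (2 * b + a) := by ring
          rw [← pow_add, this, pow_add z, pow_add w (n + a + a), ← mul_assoc, mul_assoc _ (z ^ a),
            ((hzw.symm.pow_pow _ _).mul_right (hzw.symm.pow_pow _ _)).eq]
          simp only [mul_assoc]

theorem mul_pow_prime_of_collect {p : ℕ} (hp : p.Prime) (hp5 : 5 ≤ p) {x v l z w : G}
    (hvx : v * x = x * (v * l)) (hlx : l * x = x * (l * z))
    (hlv : l * v = v * (l * w)) (hzx : Commute z x) (hzv : Commute z v) (hzl : Commute z l)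
    (hwx : Commute w x) (hwv : Commute w v) (hwl : Commute w l) (hzw : Commute z w)
    (hl : l ^ p = 1) (hz : z ^ p = 1) (hw : w ^ p = 1) : (x * v) ^ p = x ^ p * v ^ p := by
  obtain ⟨a, ha⟩ : p ∣ p.choose 2 := hp.dvd_choose_self (by norm_num) (by omega)
  obtain ⟨b, hb⟩ : p ∣ p.choose 3 := hp.dvd_choose_self (by norm_num) (by omega)
  have hc : 2 * p.choose 3 + p.choose 2 = p * (2 * b + a) := by rw [ha, hb]; ring
  rw [mul_pow_collect hvx hlx hlv hzx hzv hzl hwx hwv hwl hzw, hc, ha, hb]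
  simp [pow_mul, hl, hz, hw]

/-- In a group of class two, `p`-th powers are multiplicative on elements whose commutator has
order dividing `p`. -/
theorem mul_pow_prime_of_commute {p : ℕ} (hp : p.Prime) (hp5 : 5 ≤ p) {x v l : G}
    (hvx : v * x = x * (v * l)) (hlx : Commute l x) (hlv : Commute l v) (hl : l ^ p = 1) :
    (x * v) ^ p = x ^ p * v ^ p :=
  mul_pow_prime_of_collect hp hp5 (z := 1) (w := 1) hvx (by simpa using hlx.eq)
    (by simpa using hlv.eq) (.one_left _) (.one_left _) (.one_left _) (.one_left _) (.one_left _)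
    (.one_left _) (.one_left _) hl (one_pow _) (one_pow _)

theorem mul_swap_commutator (v x : G) : v * x = x * (v * ⁅v⁻¹, x⁻¹⁆) := by
  simp [commutatorElement_def, mul_assoc]

theorem commute_mk_of_commutator_le {Z T : Subgroup G} [T.Normal] (hZ : ⁅Z, (⊤ : Subgroup G)⁆ ≤ T)
    {z : G} (hz : z ∈ Z) (q : G ⧸ T) : Commute (z : G ⧸ T) q := by
  obtain ⟨g, rfl⟩ := QuotientGroup.mk_surjective q
  rw [← commutatorElement_eq_one_iff_commute]
  have := (QuotientGroup.eq_one_iff _).2 (hZ (commutator_mem_commutator hz (mem_top g)))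
  simpa [commutatorElement_def] using this

end Collection

section PowSubgroup

variable {G : Type*} [Group G] {p : ℕ}

theorem pow_mem_powSubgroup {H : Subgroup G} {h : G} (hh : h ∈ H) : h ^ p ∈ powSubgroup H p :=
  subset_closure ⟨h, hh, rfl⟩

theorem powSubgroup_le_iff {H K : Subgroup G} :
    powSubgroup H p ≤ K ↔ ∀ h ∈ H, h ^ p ∈ K := by
  rw [powSubgroup, closure_le]
  exact ⟨fun h x hx => h ⟨x, hx, rfl⟩, by rintro h _ ⟨x, hx, rfl⟩; exact h x hx⟩

theorem powSubgroup_le (H : Subgroup G) : powSubgroup H p ≤ H :=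
  powSubgroup_le_iff.2 fun _ hh => pow_mem hh p

theorem powSubgroup_mono {H K : Subgroup G} (h : H ≤ K) : powSubgroup H p ≤ powSubgroup K p :=
  powSubgroup_le_iff.2 fun _ hx => pow_mem_powSubgroup (h hx)

theorem map_powSubgroup {G' : Type*} [Group G'] (f : G →* G') (H : Subgroup G) :
    (powSubgroup H p).map f = powSubgroup (H.map f) p := by
  rw [powSubgroup, powSubgroup, MonoidHom.map_closure]
  congr 1
  ext y
  constructor
  · rintro ⟨_, ⟨h, hh, rfl⟩, rfl⟩
    exact ⟨f h, mem_map_of_mem f hh, (map_pow f h p).symm⟩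
  · rintro ⟨_, ⟨h, hh, rfl⟩, rfl⟩
    exact ⟨h ^ p, ⟨h, hh, rfl⟩, map_pow f h p⟩

instance powSubgroup_normal (H : Subgroup G) [hH : H.Normal] : (powSubgroup H p).Normal := by
  refine ⟨fun n hn g => ?_⟩
  have : (powSubgroup H p).map (MulAut.conj g).toMonoidHom ≤ powSubgroup H p := by
    rw [map_powSubgroup]
    refine powSubgroup_mono ?_
    rintro _ ⟨h, hh, rfl⟩
    exact hH.conj_mem h hh g
  exact this (mem_map_of_mem _ hn)

/-- Powers are multiplicative modulo `T` when commutators with `x` lie in `L` and `L`, `Z`, `T`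
descend fast enough. -/
theorem mul_pow_congr (hp : p.Prime) (hp5 : 5 ≤ p) {L Z T : Subgroup G} [T.Normal] {x v : G}
    (hl : ⁅v⁻¹, x⁻¹⁆ ∈ L) (hL : ⁅L, (⊤ : Subgroup G)⁆ ≤ Z) (hZ : ⁅Z, (⊤ : Subgroup G)⁆ ≤ T)
    (hLp : powSubgroup L p ≤ T) (hZL : Z ≤ L) :
    ((x * v : G) : G ⧸ T) ^ p = (x : G ⧸ T) ^ p * (v : G ⧸ T) ^ p := by
  have key (a b : G) : (a : G ⧸ T) * b = b * (a * (⁅a⁻¹, b⁻¹⁆ : G)) :=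
    congrArg (QuotientGroup.mk (s := T)) (mul_swap_commutator a b)
  have hz : ⁅⁅v⁻¹, x⁻¹⁆⁻¹, x⁻¹⁆ ∈ Z := hL (commutator_mem_commutator (inv_mem hl) (mem_top _))
  have hw : ⁅⁅v⁻¹, x⁻¹⁆⁻¹, v⁻¹⁆ ∈ Z := hL (commutator_mem_commutator (inv_mem hl) (mem_top _))
  have hpow {y : G} (hy : y ∈ L) : (y : G ⧸ T) ^ p = 1 :=
    (QuotientGroup.eq_one_iff _).2 (hLp (pow_mem_powSubgroup hy))
  exact mul_pow_prime_of_collect hp hp5 (key v x) (key _ x) (key _ v)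
    (commute_mk_of_commutator_le hZ hz _) (commute_mk_of_commutator_le hZ hz _)
    (commute_mk_of_commutator_le hZ hz _) (commute_mk_of_commutator_le hZ hw _)
    (commute_mk_of_commutator_le hZ hw _) (commute_mk_of_commutator_le hZ hw _)
    (commute_mk_of_commutator_le hZ hz _) (hpow hl) (hpow (hZL hz)) (hpow (hZL hw))

end PowSubgroup

section Nilpotent

variable {G : Type*} [Group G] {p : ℕ}

theorem commutator_top_le_iff {K T : Subgroup G} [T.Normal] :
    ⁅K, (⊤ : Subgroup G)⁆ ≤ T ↔ K ≤ (center (G ⧸ T)).comap (QuotientGroup.mk' T) := by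
  refine ⟨fun h k hk => mem_center_iff.2 fun q => ?_, fun h => commutator_le.2 fun k hk g _ => ?_⟩
  · exact (commute_mk_of_commutator_le h hk q).eq.symm
  · have := mem_center_iff.1 (h hk) g
    rw [← QuotientGroup.eq_one_iff]
    exact (commutatorElement_eq_one_iff_mul_comm (g₁ := (k : G ⧸ T)) (g₂ := g)).2 this.symm

theorem commutator_sup_top_le {K L T : Subgroup G} [T.Normal] (hK : ⁅K, (⊤ : Subgroup G)⁆ ≤ T)
    (hL : ⁅L, (⊤ : Subgroup G)⁆ ≤ T) : ⁅K ⊔ L, (⊤ : Subgroup G)⁆ ≤ T := by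
  rw [commutator_top_le_iff] at *
  exact sup_le hK hL

/-- In a nilpotent group a subgroup contained in `T ⊔ ⁅Y, G⁆` is already contained in `T`. -/
theorem le_of_le_sup_commutator [Group.IsNilpotent G] {Y T : Subgroup G} [hT : T.Normal]
    (h : Y ≤ T ⊔ ⁅Y, (⊤ : Subgroup G)⁆) : Y ≤ T := by
  obtain ⟨n, hn⟩ := Subgroup.nilpotent_iff_lowerCentralSeries.1 ‹Group.IsNilpotent G›
  have key (n : ℕ) : Y ≤ T ⊔ (⊤ : Subgroup G).lowerCentralSeries n := by
    induction n with
    | zero => simp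
    | succ n ih =>
      refine h.trans (sup_le le_sup_left ((commutator_mono ih le_rfl).trans ?_))
      exact commutator_sup_top_le ((commutator_le_left T ⊤).trans le_sup_left) le_sup_right
  simpa [hn] using key n

theorem isNilpotent_of_isPGroup [Finite G] (hp : p.Prime) (hG : IsPGroup p G) :
    Group.IsNilpotent G :=
  have := Fact.mk hp
  hG.isNilpotent

/-- Conjugation as right multiplication by a commutator. -/
theorem conj_eq_mul_commutator (a g : G) : g * a * g⁻¹ = a * ⁅a⁻¹, g⁆ := by
  simp [commutatorElement_def, mul_assoc]

theorem commutator_powSubgroup_le (hp : p.Prime) (hp5 : 5 ≤ p) {N T : Subgroup G} [T.Normal]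
    (hN : ⁅N, (⊤ : Subgroup G)⁆ ≤ powSubgroup N p) (hT : powSubgroup (powSubgroup N p) p ≤ T)
    (hc : ⁅⁅powSubgroup N p, (⊤ : Subgroup G)⁆, (⊤ : Subgroup G)⁆ ≤ T) :
    ⁅powSubgroup N p, (⊤ : Subgroup G)⁆ ≤ T := by
  have hNn : N.Normal := commutator_top_right_le_iff.1 (hN.trans (powSubgroup_le N))
  rw [commutator_top_le_iff]
  refine powSubgroup_le_iff.2 fun a ha => mem_center_iff.2 fun q => ?_
  obtain ⟨g, rfl⟩ := QuotientGroup.mk_surjective q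
  have hv : ⁅a⁻¹, g⁆ ∈ powSubgroup N p :=
    hN (commutator_mem_commutator (inv_mem ha) (mem_top g))
  have key := mul_pow_congr (T := T) hp hp5 (x := a) (v := ⁅a⁻¹, g⁆)
    (commutator_mem_commutator (inv_mem hv) (mem_top _)) le_rfl
    ((commutator_mono (commutator_le_left _ _) le_rfl).trans hc)
    ((powSubgroup_mono (commutator_le_left _ _)).trans hT) (commutator_le_left _ _)
  have hv' : ((⁅a⁻¹, g⁆ : G) : G ⧸ T) ^ p = 1 :=
    (QuotientGroup.eq_one_iff _).2 (hT (pow_mem_powSubgroup hv))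
  rw [hv', mul_one, ← conj_eq_mul_commutator] at key
  have : ((g : G ⧸ T) * a * (g : G ⧸ T)⁻¹) ^ p = (a : G ⧸ T) ^ p := key
  rw [conj_pow, mul_inv_eq_iff_eq_mul] at this
  exact this

theorem powSubgroup_powerfully_embedded [Group.IsNilpotent G] (hp : p.Prime) (hp5 : 5 ≤ p)
    {N : Subgroup G} (hN : ⁅N, (⊤ : Subgroup G)⁆ ≤ powSubgroup N p) :
    ⁅powSubgroup N p, (⊤ : Subgroup G)⁆ ≤ powSubgroup (powSubgroup N p) p := by
  have hNn : N.Normal := commutator_top_right_le_iff.1 (hN.trans (powSubgroup_le N))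
  exact le_of_le_sup_commutator
    (commutator_powSubgroup_le hp hp5 hN le_sup_left le_sup_right)

theorem commutator_zpowers_sup_le {N T : Subgroup G} [N.Normal] [T.Normal]
    (h : ⁅N, (⊤ : Subgroup G)⁆ ≤ T) (x : G) : ⁅zpowers x ⊔ N, zpowers x ⊔ N⁆ ≤ T := by
  refine commutator_le.2 fun a ha b hb => ?_
  obtain ⟨_, ⟨i, rfl⟩, u, hu, rfl⟩ := mem_sup_of_normal_right.1 ha
  obtain ⟨_, ⟨j, rfl⟩, v, hv, rfl⟩ := mem_sup_of_normal_right.1 hb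
  have hu' := commute_mk_of_commutator_le h hu
  have hv' := commute_mk_of_commutator_le h hv
  rw [← QuotientGroup.eq_one_iff]
  refine (commutatorElement_eq_one_iff_commute (g₁ := ((x ^ i : G) : G ⧸ T) * (u : G ⧸ T))
    (g₂ := ((x ^ j : G) : G ⧸ T) * (v : G ⧸ T))).2 (Commute.mul_left ?_ (hu' _))
  exact Commute.mul_right ((Commute.refl x).zpow_zpow i j |>.map (QuotientGroup.mk' T))
    (hv' _).symm

theorem card_subgroup_lt [Finite G] {H : Subgroup G} (h : H ≠ ⊤) : Nat.card H < Nat.card G :=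
  lt_of_le_of_ne (card_le_card_group H) fun h' => h (card_eq_iff_eq_top H |>.1 h')

theorem eq_one_of_pow_surjective [Finite G] (hG : IsPGroup p G)
    (h : Function.Surjective fun x : G => x ^ p) (g : G) : g = 1 := by
  have hinj := Finite.injective_iff_surjective.2 h
  have key (k : ℕ) : ∀ q : G, q ^ p ^ k = 1 → q = 1 := by
    induction k with
    | zero => simp
    | succ k ih =>
      intro q hq
      refine hinj ((ih (q ^ p) ?_).trans (one_pow p).symm)
      rwa [← pow_mul, ← pow_succ']
  obtain ⟨k, hk⟩ := hG g
  exact key k g hk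

theorem exists_pow_eq_of_mem_powSubgroup {H : Subgroup G}
    (hH : ∀ a ∈ H, ∀ b ∈ H, ∃ c ∈ H, c ^ p = a ^ p * b ^ p) {g : G} (hg : g ∈ powSubgroup H p) :
    ∃ a ∈ H, a ^ p = g := by
  induction hg using closure_induction with
  | mem x hx => exact hx
  | one => exact ⟨1, one_mem H, one_pow p⟩
  | mul x y _ _ hx hy =>
    obtain ⟨a, ha, rfl⟩ := hx
    obtain ⟨b, hb, rfl⟩ := hy
    exact hH a ha b hb
  | inv x _ hx =>
    obtain ⟨a, ha, rfl⟩ := hx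
    exact ⟨a⁻¹, inv_mem ha, inv_pow a p⟩

/-- A normal subgroup containing all commutators and supplementing the `p`-th powers is the whole
group. -/
theorem eq_top_of_sup_powSubgroup_eq_top [Finite G] (hG : IsPGroup p G) {M : Subgroup G}
    [M.Normal] (hcomm : ⁅(⊤ : Subgroup G), (⊤ : Subgroup G)⁆ ≤ M)
    (hs : M ⊔ powSubgroup ⊤ p = ⊤) : M = ⊤ := by
  refine eq_top_iff.2 fun g _ => (QuotientGroup.eq_one_iff g).1 ?_
  refine eq_one_of_pow_surjective (hG.to_quotient M) (fun q => ?_) _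
  have hq : q ∈ powSubgroup (⊤ : Subgroup (G ⧸ M)) p := by
    have := congrArg (Subgroup.map (QuotientGroup.mk' M)) hs
    rw [Subgroup.map_sup, map_powSubgroup, map_top_of_surjective _ (QuotientGroup.mk'_surjective M),
      QuotientGroup.map_mk'_self, bot_sup_eq] at this
    rw [this]
    exact mem_top q
  obtain ⟨a, -, ha⟩ := exists_pow_eq_of_mem_powSubgroup (fun a _ b _ => ⟨a * b, mem_top _, by
    obtain ⟨a, rfl⟩ := QuotientGroup.mk_surjective a
    exact (commute_mk_of_commutator_le hcomm (mem_top a) b).mul_pow p⟩) hq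
  exact ⟨a, ha⟩

/-- The subgroup generated by commutators and `p`-th powers consists of non-generators. -/
theorem eq_top_of_sup_frattini_eq_top [Finite G] (hp : p.Prime) (hG : IsPGroup p G)
    {H : Subgroup G}
    (h : H ⊔ (powSubgroup ⊤ p ⊔ ⁅(⊤ : Subgroup G), (⊤ : Subgroup G)⁆) = ⊤) : H = ⊤ := by
  have := isNilpotent_of_isPGroup hp hG
  refine (eq_top_or_exists_le_coatom H).resolve_right ?_
  rintro ⟨M, hM, hHM⟩
  have hMn : M.Normal :=
    NormalizerCondition.normal_of_coatom M Group.normalizerCondition_of_isNilpotent hM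
  have hcomm : ⁅(⊤ : Subgroup G), (⊤ : Subgroup G)⁆ ≤ M := by
    by_contra hc
    have hs : M ⊔ ⁅(⊤ : Subgroup G), (⊤ : Subgroup G)⁆ = ⊤ := hM.2 _ (left_lt_sup.2 hc)
    exact hM.1 (top_le_iff.1 (le_of_le_sup_commutator hs.ge))
  have hs : M ⊔ powSubgroup ⊤ p = ⊤ := by
    refine top_le_iff.1 (h.ge.trans ?_)
    exact sup_le (hHM.trans le_sup_left) (sup_le le_sup_right (hcomm.trans le_sup_left))
  exact hM.1 (eq_top_of_sup_powSubgroup_eq_top hG hcomm hs)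

end Nilpotent

section Subtype

variable {G : Type*} [Group G] {p : ℕ}

theorem map_subtype_top (H : Subgroup G) : (⊤ : Subgroup H).map H.subtype = H := by
  rw [← MonoidHom.range_eq_map, range_subtype]

theorem map_subtype_powSubgroup_top (H : Subgroup G) :
    (powSubgroup (⊤ : Subgroup H) p).map H.subtype = powSubgroup H p := by
  rw [map_powSubgroup, map_subtype_top]

theorem mem_powSubgroup_top_subtype {H : Subgroup G} {x : H} :
    x ∈ powSubgroup (⊤ : Subgroup H) p ↔ (x : G) ∈ powSubgroup H p := by
  rw [← map_subtype_powSubgroup_top H]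
  exact (mem_map_iff_mem H.subtype_injective).symm

theorem powerful_subtype {H : Subgroup G} (hH : ⁅H, H⁆ ≤ powSubgroup H p) :
    ⁅(⊤ : Subgroup H), (⊤ : Subgroup H)⁆ ≤ powSubgroup ⊤ p :=
  commutator_le.2 fun a _ b _ => mem_powSubgroup_top_subtype.2
    (hH (commutator_mem_commutator a.2 b.2))

theorem exists_root_of_commute (hc : ∀ a b : G, Commute a b) {a : G}
    (ha : a ∈ powSubgroup (⊤ : Subgroup G) p) : ∃ x, x ^ p = a := by
  obtain ⟨x, -, hx⟩ := exists_pow_eq_of_mem_powSubgroup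
    (fun a _ b _ => ⟨a * b, mem_top _, (hc a b).mul_pow p⟩) ha
  exact ⟨x, hx⟩

end Subtype

section Powerful

variable {G : Type*} [Group G] {p : ℕ}

theorem mul_pow_congr_of_powerful [Group.IsNilpotent G] (hp : p.Prime) (hp5 : 5 ≤ p)
    (hP : ⁅(⊤ : Subgroup G), (⊤ : Subgroup G)⁆ ≤ powSubgroup ⊤ p) (x v : G) :
    ((x * v : G) : G ⧸ powSubgroup (powSubgroup (⊤ : Subgroup G) p) p) ^ p = x ^ p * v ^ p :=
  have h := powSubgroup_powerfully_embedded hp hp5 hP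
  mul_pow_congr hp hp5 (hP (commutator_mem_commutator (mem_top _) (mem_top _))) h
    (commutator_le_left _ _) le_rfl (powSubgroup_le _)

theorem powerful_zpowers_sup [Group.IsNilpotent G] (hp : p.Prime) (hp5 : 5 ≤ p)
    (hP : ⁅(⊤ : Subgroup G), (⊤ : Subgroup G)⁆ ≤ powSubgroup ⊤ p) (x : G) :
    ⁅zpowers x ⊔ powSubgroup ⊤ p, zpowers x ⊔ powSubgroup ⊤ p⁆
      ≤ powSubgroup (zpowers x ⊔ powSubgroup ⊤ p) p :=
  (commutator_zpowers_sup_le (powSubgroup_powerfully_embedded hp hp5 hP) x).trans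
    (powSubgroup_mono le_sup_right)

theorem commute_of_zpowers_sup_eq_top [Finite G] (hp : p.Prime) (hG : IsPGroup p G)
    (hP : ⁅(⊤ : Subgroup G), (⊤ : Subgroup G)⁆ ≤ powSubgroup ⊤ p) {x : G}
    (hx : zpowers x ⊔ powSubgroup ⊤ p = ⊤) (a b : G) : Commute a b := by
  have h : zpowers x = ⊤ := eq_top_of_sup_frattini_eq_top hp hG (by rwa [sup_eq_left.2 hP])
  obtain ⟨i, rfl⟩ : a ∈ zpowers x := h ▸ mem_top a
  obtain ⟨j, rfl⟩ : b ∈ zpowers x := h ▸ mem_top b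
  exact (Commute.refl x).zpow_zpow i j

theorem exists_root_mul_of_powerful [Group.IsNilpotent G] (hp : p.Prime) (hp5 : 5 ≤ p)
    (hP : ⁅(⊤ : Subgroup G), (⊤ : Subgroup G)⁆ ≤ powSubgroup ⊤ p) {a : G}
    (ha : a ∈ powSubgroup (⊤ : Subgroup G) p) :
    ∃ x, ∃ b ∈ powSubgroup (powSubgroup (⊤ : Subgroup G) p) p, x ^ p * b = a := by
  have ha' : (a : G ⧸ powSubgroup (powSubgroup (⊤ : Subgroup G) p) p) ∈ powSubgroup ⊤ p := by
    rw [← map_top_of_surjective _ (QuotientGroup.mk'_surjective _), ← map_powSubgroup]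
    exact mem_map_of_mem _ ha
  obtain ⟨x, -, hx⟩ := exists_pow_eq_of_mem_powSubgroup (fun a _ b _ => ⟨a * b, mem_top _, by
    obtain ⟨a, rfl⟩ := QuotientGroup.mk_surjective a
    obtain ⟨b, rfl⟩ := QuotientGroup.mk_surjective b
    exact mul_pow_congr_of_powerful hp hp5 hP a b⟩) ha'
  obtain ⟨x, rfl⟩ := QuotientGroup.mk_surjective x
  exact ⟨x, (x ^ p)⁻¹ * a, QuotientGroup.eq.1 hx, mul_inv_cancel_left _ _⟩

/-- In a powerful `p`-group every product of `p`-th powers is a `p`-th power. -/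
theorem exists_root_of_powerful (hp : p.Prime) (hp5 : 5 ≤ p) {G : Type u} [Group G] [Finite G]
    (hG : IsPGroup p G) (hP : ⁅(⊤ : Subgroup G), (⊤ : Subgroup G)⁆ ≤ powSubgroup ⊤ p) {a : G}
    (ha : a ∈ powSubgroup (⊤ : Subgroup G) p) : ∃ x, x ^ p = a := by
  induction hn : Nat.card G using Nat.strong_induction_on generalizing G with
  | _ n ih =>
  subst hn
  have := isNilpotent_of_isPGroup hp hG
  obtain ⟨x, b, hb, rfl⟩ := exists_root_mul_of_powerful hp hp5 hP ha
  by_cases hx : zpowers x ⊔ powSubgroup ⊤ p = ⊤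
  · exact exists_root_of_commute (commute_of_zpowers_sup_eq_top hp hG hP hx) ha
  have hxH : x ∈ zpowers x ⊔ powSubgroup ⊤ p :=
    le_sup_left (a := zpowers x) (mem_zpowers x)
  have hmem := mul_mem (pow_mem_powSubgroup (p := p) hxH) (powSubgroup_mono le_sup_right hb)
  obtain ⟨y, hy⟩ := ih _ (card_subgroup_lt hx) (hG.to_subgroup _)
    (powerful_subtype (powerful_zpowers_sup hp hp5 hP x))
    (mem_powSubgroup_top_subtype (x := ⟨_, powSubgroup_le _ hmem⟩) |>.2 hmem) rfl
  exact ⟨y, congrArg Subtype.val hy⟩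

variable {G : Type u} [Group G] [Finite G]

theorem exists_root_of_powerful_subgroup (hp : p.Prime) (hp5 : 5 ≤ p) (hG : IsPGroup p G)
    {H : Subgroup G} (hH : ⁅H, H⁆ ≤ powSubgroup H p) {a : G} (ha : a ∈ powSubgroup H p) :
    ∃ x ∈ H, x ^ p = a := by
  obtain ⟨y, hy⟩ := exists_root_of_powerful hp hp5 (hG.to_subgroup H) (powerful_subtype hH)
    (mem_powSubgroup_top_subtype (x := ⟨a, powSubgroup_le _ ha⟩) |>.2 ha)
  exact ⟨y, y.2, congrArg Subtype.val hy⟩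

theorem mul_pow_congr_of_powerful_subgroup (hp : p.Prime) (hp5 : 5 ≤ p) (hG : IsPGroup p G)
    {H : Subgroup G} (hH : ⁅H, H⁆ ≤ powSubgroup H p) {a b : G} (ha : a ∈ H) (hb : b ∈ H) :
    ((a * b) ^ p)⁻¹ * (a ^ p * b ^ p) ∈ powSubgroup (powSubgroup H p) p := by
  have := isNilpotent_of_isPGroup hp (hG.to_subgroup H)
  have h := QuotientGroup.eq.1
    (mul_pow_congr_of_powerful hp hp5 (powerful_subtype hH) ⟨a, ha⟩ ⟨b, hb⟩)
  have h2 := mem_map_of_mem H.subtype h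
  rwa [map_powSubgroup, map_subtype_powSubgroup_top] at h2

theorem commutator_powSubgroup_le_of_powerful (hp : p.Prime) (hp5 : 5 ≤ p) (hG : IsPGroup p G)
    {H : Subgroup G} (hH : ⁅H, H⁆ ≤ powSubgroup H p) :
    ⁅powSubgroup H p, H⁆ ≤ powSubgroup (powSubgroup H p) p := by
  have := isNilpotent_of_isPGroup hp (hG.to_subgroup H)
  have h := map_mono (f := H.subtype)
    (powSubgroup_powerfully_embedded hp hp5 (powerful_subtype hH))
  simpa only [map_commutator, map_powSubgroup, map_subtype_top] using h

theorem powSubgroup_lt_of_powerful (hp : p.Prime) (hp5 : 5 ≤ p) (hG : IsPGroup p G)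
    {H : Subgroup G} (hH : ⁅H, H⁆ ≤ powSubgroup H p) (hne : H ≠ ⊥) : powSubgroup H p < H := by
  refine lt_of_le_of_ne (powSubgroup_le H) fun heq => hne ((eq_bot_iff_forall H).2 fun g hg => ?_)
  have := eq_one_of_pow_surjective (hG.to_subgroup H) (fun a => ?_) ⟨g, hg⟩
  · exact congrArg Subtype.val this
  · obtain ⟨x, hx, hxa⟩ := exists_root_of_powerful_subgroup hp hp5 hG hH (heq.ge a.2)
    exact ⟨⟨x, hx⟩, Subtype.ext hxa⟩

end Powerful

section PowSeries

/-- The series of iterated `p`-th power subgroups. -/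
def powSeries (p : ℕ) (G : Type*) [Group G] : ℕ → Subgroup G
  | 0 => ⊤
  | n + 1 => powSubgroup (powSeries p G n) p

variable {p : ℕ} {G : Type u} [Group G]

theorem powSeries_succ_le (n : ℕ) : powSeries p G (n + 1) ≤ powSeries p G n := powSubgroup_le _

theorem powSeries_antitone : Antitone (powSeries p G) := antitone_nat_of_succ_le powSeries_succ_le

instance powSeries_normal (n : ℕ) : (powSeries p G n).Normal := by
  induction n with
  | zero => exact inferInstanceAs (⊤ : Subgroup G).Normal
  | succ n _ => exact powSubgroup_normal _

theorem commutator_powSeries_le [Group.IsNilpotent G] (hp : p.Prime) (hp5 : 5 ≤ p)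
    (hP : ⁅(⊤ : Subgroup G), (⊤ : Subgroup G)⁆ ≤ powSubgroup ⊤ p) (n : ℕ) :
    ⁅powSeries p G n, (⊤ : Subgroup G)⁆ ≤ powSeries p G (n + 1) := by
  induction n with
  | zero => exact hP
  | succ n ih => exact powSubgroup_powerfully_embedded hp hp5 ih

variable [Finite G]

theorem exists_root_of_mem_powSeries (hp : p.Prime) (hp5 : 5 ≤ p) (hG : IsPGroup p G)
    (hP : ⁅(⊤ : Subgroup G), (⊤ : Subgroup G)⁆ ≤ powSubgroup ⊤ p) {n : ℕ} {a : G}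
    (ha : a ∈ powSeries p G (n + 1)) : ∃ x ∈ powSeries p G n, x ^ p = a := by
  have := isNilpotent_of_isPGroup hp hG
  exact exists_root_of_powerful_subgroup hp hp5 hG
    ((commutator_mono le_rfl le_top).trans (commutator_powSeries_le hp hp5 hP n)) ha

theorem exists_powSeries_eq_bot (hp : p.Prime) (hp5 : 5 ≤ p) (hG : IsPGroup p G)
    (hP : ⁅(⊤ : Subgroup G), (⊤ : Subgroup G)⁆ ≤ powSubgroup ⊤ p) :
    ∃ n, powSeries p G n = ⊥ := by
  have := isNilpotent_of_isPGroup hp hG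
  by_contra! h
  have (n : ℕ) : powSeries p G (n + 1) < powSeries p G n :=
    powSubgroup_lt_of_powerful hp hp5 hG
      ((commutator_mono le_rfl le_top).trans (commutator_powSeries_le hp hp5 hP n)) (h n)
  exact not_injective_infinite_finite _ (strictAnti_nat_of_succ_lt this).injective

end PowSeries

section Omega

/-- Elements of order dividing `p` are closed under multiplication, and those that are `p`-th
powers commute with all of them. -/
def OmegaRegular (p : ℕ) (G : Type*) [Group G] : Prop :=
  (∀ x y : G, x ^ p = 1 → y ^ p = 1 → (x * y) ^ p = 1) ∧
    ∀ a y : G, (a ^ p) ^ p = 1 → y ^ p = 1 → Commute (a ^ p) y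

variable {p : ℕ} {G : Type u} [Group G]

theorem mem_closure_torsion_iff (h : ∀ x y : G, x ^ p = 1 → y ^ p = 1 → (x * y) ^ p = 1) {g : G} :
    g ∈ closure {x : G | x ^ p = 1} ↔ g ^ p = 1 := by
  refine ⟨fun hg => ?_, fun hg => subset_closure hg⟩
  induction hg using closure_induction with
  | mem x hx => exact hx
  | one => exact one_pow p
  | mul x y _ _ hx hy => exact h x y hx hy
  | inv x _ hx => rw [inv_pow, hx, inv_one]

theorem conj_pow_eq_one {x : G} (hx : x ^ p = 1) (g : G) : (g * x * g⁻¹) ^ p = 1 := by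
  rw [conj_pow, hx, mul_one, mul_inv_cancel]

instance closure_torsion_normal : (closure {x : G | x ^ p = 1}).Normal := by
  refine ⟨fun n hn g => ?_⟩
  have : (closure {x : G | x ^ p = 1}).map (MulAut.conj g).toMonoidHom
      ≤ closure {x : G | x ^ p = 1} := by
    rw [MonoidHom.map_closure, closure_le]
    rintro _ ⟨x, hx, rfl⟩
    exact subset_closure (conj_pow_eq_one hx g)
  exact this (mem_map_of_mem _ hn)

theorem powerful_quotient (N : Subgroup G) [N.Normal]
    (hP : ⁅(⊤ : Subgroup G), (⊤ : Subgroup G)⁆ ≤ powSubgroup ⊤ p) :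
    ⁅(⊤ : Subgroup (G ⧸ N)), (⊤ : Subgroup (G ⧸ N))⁆ ≤ powSubgroup ⊤ p := by
  have := map_mono (f := QuotientGroup.mk' N) hP
  rwa [map_commutator, map_powSubgroup,
    map_top_of_surjective _ (QuotientGroup.mk'_surjective N)] at this

theorem commutator_pow_eq_one_of_quotient
    (hA : ∀ x y : G, x ^ p = 1 → y ^ p = 1 → (x * y) ^ p = 1)
    (hQ : OmegaRegular p (G ⧸ closure {x : G | x ^ p = 1})) {g k : G}
    (hg : ((g ^ p) ^ p) ^ p = 1) (hk : (k ^ p) ^ p = 1) : ⁅g ^ p, k⁆ ^ p = 1 := by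
  rw [← mem_closure_torsion_iff hA, ← QuotientGroup.eq_one_iff]
  have h := hQ.2 (g : G ⧸ closure {x : G | x ^ p = 1}) k
    ((QuotientGroup.eq_one_iff _).2 (subset_closure hg))
    ((QuotientGroup.eq_one_iff _).2 (subset_closure hk))
  exact commutatorElement_eq_one_iff_commute.2 h

/-- The properties of the subgroups `⟨x⟩ G ^ p` from which regularity of the `p`-torsion of `G` is
deduced. -/
structure LocallyOmegaRegular (p : ℕ) (G : Type u) [Group G] : Prop where
  regular : ∀ x : G, OmegaRegular p ↥(zpowers x ⊔ powSubgroup ⊤ p)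
  quotient : ∀ x : G, OmegaRegular p (↥(zpowers x ⊔ powSubgroup ⊤ p) ⧸
    closure {y : ↥(zpowers x ⊔ powSubgroup ⊤ p) | y ^ p = 1})

namespace LocallyOmegaRegular

theorem mul_pow (h : LocallyOmegaRegular p G) (x : G) {a b : G}
    (ha : a ∈ zpowers x ⊔ powSubgroup ⊤ p) (hb : b ∈ zpowers x ⊔ powSubgroup ⊤ p)
    (hap : a ^ p = 1) (hbp : b ^ p = 1) : (a * b) ^ p = 1 :=
  congrArg Subtype.val ((h.regular x).1 ⟨a, ha⟩ ⟨b, hb⟩ (Subtype.ext hap) (Subtype.ext hbp))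

theorem commute_pow (h : LocallyOmegaRegular p G) (x : G) {a y : G}
    (ha : a ∈ zpowers x ⊔ powSubgroup ⊤ p) (hy : y ∈ zpowers x ⊔ powSubgroup ⊤ p)
    (hap : (a ^ p) ^ p = 1) (hyp : y ^ p = 1) : Commute (a ^ p) y :=
  congrArg Subtype.val ((h.regular x).2 ⟨a, ha⟩ ⟨y, hy⟩ (Subtype.ext hap) (Subtype.ext hyp))

theorem commutator_pow_pow (h : LocallyOmegaRegular p G) (x : G) {g k : G}
    (hg : g ∈ zpowers x ⊔ powSubgroup ⊤ p) (hk : k ∈ zpowers x ⊔ powSubgroup ⊤ p)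
    (hgp : ((g ^ p) ^ p) ^ p = 1) (hkp : (k ^ p) ^ p = 1) : ⁅g ^ p, k⁆ ^ p = 1 :=
  congrArg Subtype.val (commutator_pow_eq_one_of_quotient (h.regular x).1 (h.quotient x)
    (g := ⟨g, hg⟩) (k := ⟨k, hk⟩) (Subtype.ext hgp) (Subtype.ext hkp))

theorem commutator_pow (h : LocallyOmegaRegular p G)
    (hP : ⁅(⊤ : Subgroup G), (⊤ : Subgroup G)⁆ ≤ powSubgroup ⊤ p) {x : G} (hx : x ^ p = 1)
    (g : G) : ⁅x, g⁆ ^ p = 1 := by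
  have hxH : x ∈ zpowers x ⊔ powSubgroup ⊤ p := le_sup_left (a := zpowers x) (mem_zpowers x)
  have hc : ⁅x, g⁆ ∈ zpowers x ⊔ powSubgroup ⊤ p :=
    le_sup_right (a := zpowers x) (hP (commutator_mem_commutator (mem_top x) (mem_top g)))
  have heq : ⁅x, g⁆ = x * (g * x⁻¹ * g⁻¹) := by simp [commutatorElement_def, mul_assoc]
  have hmem : g * x⁻¹ * g⁻¹ ∈ zpowers x ⊔ powSubgroup ⊤ p := by
    rwa [heq, Subgroup.mul_mem_cancel_left _ hxH] at hc
  rw [heq]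
  exact h.mul_pow x hxH hmem hx (conj_pow_eq_one (by rw [inv_pow, hx, inv_one]) g)

theorem commutator_pow' (h : LocallyOmegaRegular p G)
    (hP : ⁅(⊤ : Subgroup G), (⊤ : Subgroup G)⁆ ≤ powSubgroup ⊤ p) {x : G} (hx : x ^ p = 1)
    (g : G) : ⁅g, x⁆ ^ p = 1 := by
  rw [← commutatorElement_inv, inv_pow, h.commutator_pow hP hx, inv_one]

variable [Finite G]

theorem commute_of_mem_powSubgroup (h : LocallyOmegaRegular p G) (hp : p.Prime) (hp5 : 5 ≤ p)
    (hG : IsPGroup p G) (hP : ⁅(⊤ : Subgroup G), (⊤ : Subgroup G)⁆ ≤ powSubgroup ⊤ p) {v w : G}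
    (hv : v ∈ powSubgroup (⊤ : Subgroup G) p) (hw : w ∈ powSubgroup (⊤ : Subgroup G) p)
    (hvp : v ^ p = 1) (hwp : w ^ p = 1) : Commute v w := by
  obtain ⟨a, rfl⟩ := exists_root_of_powerful hp hp5 hG hP hv
  exact h.commute_pow a (le_sup_left (a := zpowers a) (mem_zpowers a))
    (le_sup_right (a := zpowers a) hw) hvp hwp

theorem commute_of_mem_powSeries (h : LocallyOmegaRegular p G) (hp : p.Prime) (hp5 : 5 ≤ p)
    (hG : IsPGroup p G) (hP : ⁅(⊤ : Subgroup G), (⊤ : Subgroup G)⁆ ≤ powSubgroup ⊤ p) (x : G)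
    {i : ℕ} {e k : G} (he : e ∈ powSeries p G (i + 3)) (hep : e ^ p = 1)
    (hk : k ∈ zpowers x ⊔ powSubgroup ⊤ p) (hkp : (k ^ p) ^ p = 1) : Commute e k := by
  have := isNilpotent_of_isPGroup hp hG
  have hcomm := commutator_powSeries_le hp hp5 hP
  obtain ⟨N, hN⟩ := exists_powSeries_eq_bot hp hp5 hG hP
  obtain ⟨m, hm⟩ : ∃ m, N ≤ i + m := ⟨N, Nat.le_add_left N i⟩
  induction m generalizing i e k with
  | zero =>
    have : e = 1 := by
      rw [← mem_bot, ← hN]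
      exact powSeries_antitone (by omega) he
    exact this ▸ Commute.one_left k
  | succ m ih =>
    obtain ⟨f, hf, rfl⟩ := exists_root_of_mem_powSeries hp hp5 hG hP (n := i + 2) he
    obtain ⟨g, hg, rfl⟩ := exists_root_of_mem_powSeries hp hp5 hG hP (n := i + 1) hf
    have hle {n : ℕ} : powSeries p G (n + 1) ≤ zpowers x ⊔ powSubgroup ⊤ p :=
      (powSeries_antitone (Nat.le_add_left 1 n)).trans le_sup_right
    have hs : ⁅(g ^ p)⁻¹, k⁆ ^ p = 1 := by
      rw [← inv_pow]
      exact h.commutator_pow_pow x (inv_mem (hle hg)) hk (by simp [hep]) hkp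
    have hsm : ⁅(g ^ p)⁻¹, k⁆ ∈ powSeries p G (i + 3) :=
      hcomm (i + 2) (commutator_mem_commutator (inv_mem hf) (mem_top k))
    have hlp : ⁅⁅(g ^ p)⁻¹, k⁆⁻¹, (g ^ p)⁻¹⁆ ^ p = 1 :=
      h.commutator_pow hP (by rw [inv_pow, hs, inv_one]) _
    have hlm : ⁅⁅(g ^ p)⁻¹, k⁆⁻¹, (g ^ p)⁻¹⁆ ∈ powSeries p G (i + 1 + 3) :=
      hcomm (i + 3) (commutator_mem_commutator (inv_mem hsm) (mem_top _))
    have key := mul_pow_prime_of_commute hp hp5 (mul_swap_commutator ⁅(g ^ p)⁻¹, k⁆ (g ^ p))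
      (ih hlm hlp (hle hf) hep (by omega))
      (ih hlm hlp (hle hsm) (by rw [hs, one_pow]) (by omega)) hlp
    rw [← conj_eq_mul_commutator, hs, mul_one, conj_pow, mul_inv_eq_iff_eq_mul] at key
    exact key.symm

theorem commute_of_pow_pow (h : LocallyOmegaRegular p G) (hp : p.Prime) (hp5 : 5 ≤ p)
    (hG : IsPGroup p G) (hP : ⁅(⊤ : Subgroup G), (⊤ : Subgroup G)⁆ ≤ powSubgroup ⊤ p) {k x : G}
    (hk : (k ^ p) ^ p = 1) (hx : x ^ p = 1) : Commute (k ^ p) x := by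
  have := isNilpotent_of_isPGroup hp hG
  have hcomm := commutator_powSeries_le hp hp5 hP
  have hV {n m : ℕ} {v w : G} (hv : v ∈ powSeries p G (n + 1)) (hw : w ∈ powSeries p G (m + 1))
      (hvp : v ^ p = 1) (hwp : w ^ p = 1) : Commute v w :=
    h.commute_of_mem_powSubgroup hp hp5 hG hP (powSeries_antitone (Nat.le_add_left 1 n) hv)
      (powSeries_antitone (Nat.le_add_left 1 m) hw) hvp hwp
  have hinv {y : G} (hy : y ^ p = 1) : y⁻¹ ^ p = 1 := by rw [inv_pow, hy, inv_one]
  obtain ⟨c, hc⟩ : ∃ c, c = ⁅k⁻¹, x⁆ := ⟨_, rfl⟩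
  have hcm : c ∈ powSeries p G 1 :=
    hc ▸ hcomm 0 (commutator_mem_commutator (mem_top _) (mem_top _))
  have hcp : c ^ p = 1 := hc ▸ h.commutator_pow' hP hx _
  obtain ⟨l, hl⟩ : ∃ l, l = ⁅c⁻¹, k⁻¹⁆ := ⟨_, rfl⟩
  have hlm : l ∈ powSeries p G 2 :=
    hl ▸ hcomm 1 (commutator_mem_commutator (inv_mem hcm) (mem_top _))
  have hlp : l ^ p = 1 := hl ▸ h.commutator_pow hP (hinv hcp) _
  obtain ⟨z, hz⟩ : ∃ z, z = ⁅l⁻¹, k⁻¹⁆ := ⟨_, rfl⟩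
  have hzm : z ∈ powSeries p G 3 :=
    hz ▸ hcomm 2 (commutator_mem_commutator (inv_mem hlm) (mem_top _))
  have hzp : z ^ p = 1 := hz ▸ h.commutator_pow hP (hinv hlp) _
  have hzk : Commute z k := h.commute_of_mem_powSeries hp hp5 hG hP k (i := 0) hzm hzp
    (le_sup_left (a := zpowers k) (mem_zpowers k)) hk
  have key := mul_pow_prime_of_collect hp hp5 (w := 1) (hl ▸ mul_swap_commutator c k)
    (hz ▸ mul_swap_commutator l k) (by simpa using (hV hlm hcm hlp hcp).eq) hzk
    (hV hzm hcm hzp hcp) (hV hzm hlm hzp hlp) (.one_left _) (.one_left _) (.one_left _)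
    (.one_right _) hlp hzp (one_pow p)
  rw [hcp, mul_one, hc, ← conj_eq_mul_commutator, conj_pow, mul_inv_eq_iff_eq_mul] at key
  exact key.symm

theorem omegaRegular (h : LocallyOmegaRegular p G) (hp : p.Prime) (hp5 : 5 ≤ p)
    (hG : IsPGroup p G) (hP : ⁅(⊤ : Subgroup G), (⊤ : Subgroup G)⁆ ≤ powSubgroup ⊤ p) :
    OmegaRegular p G := by
  refine ⟨fun x y hx hy => ?_, fun a y ha hy => h.commute_of_pow_pow hp hp5 hG hP ha hy⟩
  have hdp : ⁅y⁻¹, x⁻¹⁆ ^ p = 1 := h.commutator_pow hP (by rw [inv_pow, hy, inv_one]) _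
  obtain ⟨a, ha⟩ := exists_root_of_powerful hp hp5 hG hP
    (hP (commutator_mem_commutator (mem_top y⁻¹) (mem_top x⁻¹)))
  have hd {t : G} (ht : t ^ p = 1) : Commute ⁅y⁻¹, x⁻¹⁆ t := by
    rw [← ha] at hdp ⊢
    exact h.commute_of_pow_pow hp hp5 hG hP hdp ht
  rw [mul_pow_prime_of_commute hp hp5 (mul_swap_commutator y x) (hd hx) (hd hy) hdp, hx, hy,
    one_mul]

end LocallyOmegaRegular

theorem omegaRegular_of_powerful {G : Type u} [Group G] [Finite G] (hp : p.Prime) (hp5 : 5 ≤ p)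
    (hG : IsPGroup p G) (hP : ⁅(⊤ : Subgroup G), (⊤ : Subgroup G)⁆ ≤ powSubgroup ⊤ p) :
    OmegaRegular p G := by
  induction hn : Nat.card G using Nat.strong_induction_on generalizing G with
  | _ n ih =>
  subst hn
  have := isNilpotent_of_isPGroup hp hG
  by_cases hcyc : ∃ x : G, zpowers x ⊔ powSubgroup ⊤ p = ⊤
  · obtain ⟨x, hx⟩ := hcyc
    have hc := commute_of_zpowers_sup_eq_top hp hG hP hx
    exact ⟨fun x y hx hy => by rw [(hc x y).mul_pow, hx, hy, one_mul], fun a y _ _ => hc _ _⟩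
  push Not at hcyc
  have hlt (x : G) := card_subgroup_lt (hcyc x)
  have hH (x : G) := powerful_subtype (powerful_zpowers_sup hp hp5 hP x)
  exact LocallyOmegaRegular.omegaRegular
    ⟨fun x => ih _ (hlt x) (hG.to_subgroup _) (hH x) rfl,
      fun x => ih _ ((Nat.card_le_card_of_surjective _ QuotientGroup.mk_surjective).trans_lt
        (hlt x))
        ((hG.to_subgroup _).to_quotient _) (powerful_quotient _ (hH x)) rfl⟩ hp hp5 hG hP

end Omega

section Translate

variable {p : ℕ} {G : Type u} [Group G] [Finite G]

theorem commutator_powSubgroup_le_of_le_powerful (hp : p.Prime) (hp5 : 5 ≤ p) (hG : IsPGroup p G)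
    {P M K T : Subgroup G} [T.Normal] (hP : ⁅P, P⁆ ≤ powSubgroup P p) (hM : M ≤ P) (hK : K ≤ P)
    (hMK : ⁅M, (⊤ : Subgroup G)⁆ ≤ K) (hKT : powSubgroup K p ≤ T)
    (hPT : powSubgroup (powSubgroup P p) p ≤ T) : ⁅powSubgroup M p, (⊤ : Subgroup G)⁆ ≤ T := by
  rw [commutator_top_le_iff]
  refine powSubgroup_le_iff.2 fun m hm => mem_center_iff.2 fun q => ?_
  obtain ⟨g, rfl⟩ := QuotientGroup.mk_surjective q
  have hu : ⁅m⁻¹, g⁆ ∈ K := hMK (commutator_mem_commutator (inv_mem hm) (mem_top g))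
  have key : ((m * ⁅m⁻¹, g⁆ : G) : G ⧸ T) ^ p = m ^ p * (⁅m⁻¹, g⁆ : G) ^ p := QuotientGroup.eq.2
    (hPT (mul_pow_congr_of_powerful_subgroup hp hp5 hG hP (hM hm) (hK hu)))
  have hu' : ((⁅m⁻¹, g⁆ : G) : G ⧸ T) ^ p = 1 :=
    (QuotientGroup.eq_one_iff _).2 (hKT (pow_mem_powSubgroup hu))
  rw [hu', mul_one, ← conj_eq_mul_commutator] at key
  have : ((g : G ⧸ T) * m * (g : G ⧸ T)⁻¹) ^ p = (m : G ⧸ T) ^ p := key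
  rw [conj_pow, mul_inv_eq_iff_eq_mul] at this
  exact this

theorem exists_root_mul_of_le_powerful (hp : p.Prime) (hp5 : 5 ≤ p) (hG : IsPGroup p G)
    {P L : Subgroup G} [P.Normal] (hP : ⁅P, P⁆ ≤ powSubgroup P p) (hL : L ≤ P) {a : G}
    (ha : a ∈ powSubgroup L p ⊔ powSubgroup (powSubgroup P p) p) :
    ∃ l ∈ L, ∃ q ∈ powSubgroup (powSubgroup P p) p, l ^ p * q = a := by
  have ha' : (a : G ⧸ powSubgroup (powSubgroup P p) p)
      ∈ powSubgroup (L.map (QuotientGroup.mk' _)) p := by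
    have := mem_map_of_mem (QuotientGroup.mk' (powSubgroup (powSubgroup P p) p)) ha
    rwa [Subgroup.map_sup, QuotientGroup.map_mk'_self, sup_bot_eq, map_powSubgroup] at this
  obtain ⟨_, ⟨l, hl, rfl⟩, hx⟩ := exists_pow_eq_of_mem_powSubgroup (by
    rintro _ ⟨a, ha, rfl⟩ _ ⟨b, hb, rfl⟩
    exact ⟨_, mem_map_of_mem _ (mul_mem ha hb), QuotientGroup.eq.2
      (mul_pow_congr_of_powerful_subgroup hp hp5 hG hP (hL ha) (hL hb))⟩) ha'
  exact ⟨l, hl, (l ^ p)⁻¹ * a, QuotientGroup.eq.1 hx, mul_inv_cancel_left _ _⟩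

/-- An element whose `p`-th power lies in `P ^ p`, with `P` powerful and suitably embedded, can be
translated by an element of `P` to an element of order dividing `p`. -/
theorem exists_mul_pow_eq_one (hp : p.Prime) (hp5 : 5 ≤ p) (hG : IsPGroup p G)
    {P L : Subgroup G} (hP : ⁅P, P⁆ ≤ powSubgroup P p) (hPL : powSubgroup P p ≤ L) (hLP : L ≤ P)
    (h₁ : ⁅P, (⊤ : Subgroup G)⁆ ≤ L) (h₂ : ⁅L, (⊤ : Subgroup G)⁆ ≤ powSubgroup P p) {x : G}
    (hx : x ^ p ∈ powSubgroup P p) : ∃ v ∈ P, (x * v) ^ p = 1 := by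
  induction hn : Nat.card P using Nat.strong_induction_on generalizing P L x with
  | _ n ih =>
  subst hn
  have hPn : P.Normal := commutator_top_right_le_iff.1 (h₁.trans hLP)
  have hLn : L.Normal := commutator_top_right_le_iff.1 (h₂.trans hPL)
  by_cases hbot : P = ⊥
  · subst hbot
    exact ⟨1, one_mem _, by rw [mul_one]; exact mem_bot.1 (powSubgroup_le _ hx)⟩
  have hlt := powSubgroup_lt_of_powerful hp hp5 hG hP hbot
  obtain ⟨P', hP'⟩ : ∃ P', P' = powSubgroup P p := ⟨_, rfl⟩
  have hP'n : P'.Normal := hP' ▸ inferInstance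
  obtain ⟨L', hL'⟩ : ∃ L', L' = powSubgroup L p ⊔ powSubgroup P' p := ⟨_, rfl⟩
  have hL'n : L'.Normal := hL' ▸ inferInstance
  have hle : powSubgroup L p ≤ L' := hL' ▸ le_sup_left
  have hle' : powSubgroup P' p ≤ L' := hL' ▸ le_sup_right
  have hL'P' : L' ≤ P' := by
    rw [hL', hP']
    exact sup_le (powSubgroup_mono hLP) (powSubgroup_le _)
  have hc₁ : ⁅P', (⊤ : Subgroup G)⁆ ≤ L' := by
    rw [hP']
    exact commutator_powSubgroup_le_of_le_powerful hp hp5 hG hP le_rfl hLP h₁ hle (hP' ▸ hle')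
  have hc₂ : ⁅L', (⊤ : Subgroup G)⁆ ≤ powSubgroup P' p := by
    rw [hL']
    refine commutator_sup_top_le ?_ (commutator_le_left _ _)
    rw [hP'] at *
    exact commutator_powSubgroup_le_of_le_powerful hp hp5 hG hP hLP hlt.le h₂ le_rfl le_rfl
  have hc : ⁅P', P'⁆ ≤ powSubgroup P' p := by
    rw [hP']
    exact (commutator_mono le_rfl hlt.le).trans
      (commutator_powSubgroup_le_of_powerful hp hp5 hG hP)
  obtain ⟨m, hm, hmx⟩ := exists_root_of_powerful_subgroup hp hp5 hG hP hx
  have hA : (x * m⁻¹) ^ p ∈ L' := by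
    have := mul_pow_congr (T := L') hp hp5 (x := x) (v := m⁻¹) (L := L) (Z := P')
      (h₁ (commutator_mem_commutator (inv_mem (inv_mem hm)) (mem_top _))) (hP' ▸ h₂) hc₁ hle
      (hP' ▸ hPL)
    refine (QuotientGroup.eq_one_iff _).1 (this.trans ?_)
    refine (QuotientGroup.eq_one_iff (x ^ p * m⁻¹ ^ p)).2 ?_
    rw [inv_pow, hmx, mul_inv_cancel]
    exact one_mem _
  have hA' : (x * m⁻¹) ^ p ∈ powSubgroup L p ⊔ powSubgroup (powSubgroup P p) p := by
    rwa [hL', hP'] at hA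
  obtain ⟨l, hl, q, hq, hlq⟩ := exists_root_mul_of_le_powerful hp hp5 hG hP hLP hA'
  rw [← hP'] at hq
  have hB : (x * m⁻¹ * l⁻¹) ^ p ∈ powSubgroup P' p := by
    have := mul_pow_congr (T := powSubgroup P' p) hp hp5 (x := x * m⁻¹) (v := l⁻¹) (L := P')
      (Z := L') (hP' ▸ h₂ (commutator_mem_commutator (inv_mem (inv_mem hl)) (mem_top _)))
      hc₁ hc₂ le_rfl hL'P'
    refine (QuotientGroup.eq_one_iff _).1 (this.trans ?_)
    refine (QuotientGroup.eq_one_iff ((x * m⁻¹) ^ p * l⁻¹ ^ p)).2 ?_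
    rw [inv_pow, ← hlq]
    exact Normal.conj_mem inferInstance q hq _
  obtain ⟨v, hv, hxv⟩ := ih _ (hP' ▸ Set.ncard_lt_ncard hlt) hc hle' hL'P' hc₁ hc₂ hB rfl
  refine ⟨m⁻¹ * (l⁻¹ * v),
    mul_mem (inv_mem hm) (mul_mem (inv_mem (hLP hl)) (hlt.le (hP' ▸ hv))), ?_⟩
  rwa [← mul_assoc, ← mul_assoc]

end Translate

section Counting

variable {p : ℕ} {G : Type u} [Group G]

theorem card_mul_relIndex_of_le {H K : Subgroup G} (h : H ≤ K) :
    Nat.card H * H.relIndex K = Nat.card K := by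
  rw [← relIndex_bot_left, ← relIndex_bot_left, relIndex_mul_relIndex ⊥ H K bot_le h]

theorem card_sup_mul_card_inf (H K : Subgroup G) [H.Normal] :
    Nat.card ↥(H ⊔ K) * Nat.card ↥(H ⊓ K) = Nat.card H * Nat.card K := by
  rw [← card_mul_relIndex_of_le (le_sup_left : H ≤ H ⊔ K), relIndex_sup_left,
    ← inf_relIndex_right, ← card_mul_relIndex_of_le (inf_le_right : H ⊓ K ≤ K)]
  ring

theorem card_map_subtype {H : Subgroup G} (K : Subgroup H) :
    Nat.card (K.map H.subtype) = Nat.card K :=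
  Nat.card_congr (K.equivMapOfInjective _ H.subtype_injective).toEquiv.symm

theorem map_subtype_closure_torsion_le (H : Subgroup G) :
    (closure {x : H | x ^ p = 1}).map H.subtype ≤ H ⊓ closure {x : G | x ^ p = 1} := by
  refine le_inf ((map_mono le_top).trans (map_subtype_top H).le) ?_
  rw [MonoidHom.map_closure, closure_le]
  rintro _ ⟨x, hx, rfl⟩
  exact subset_closure (congrArg Subtype.val hx)

theorem map_subtype_closure_torsion
    (h : ∀ x y : G, x ^ p = 1 → y ^ p = 1 → (x * y) ^ p = 1) (H : Subgroup G) :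
    (closure {x : H | x ^ p = 1}).map H.subtype = H ⊓ closure {x : G | x ^ p = 1} := by
  refine le_antisymm (map_subtype_closure_torsion_le H) fun x hx => ?_
  exact ⟨⟨x, hx.1⟩, subset_closure (Subtype.ext ((mem_closure_torsion_iff h).1 hx.2)), rfl⟩

theorem card_powSubgroup_top_subtype (H : Subgroup G) :
    Nat.card (powSubgroup (⊤ : Subgroup H) p) = Nat.card (powSubgroup H p) := by
  rw [← card_map_subtype, map_subtype_powSubgroup_top]

/-- If taking `p`-th powers is multiplicative modulo `T`, the preimage of `T` has index
`|G ^ p : T|`. -/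
theorem exists_powKer {T : Subgroup G} [T.Normal] (hT : T ≤ powSubgroup ⊤ p)
    (hmul : ∀ x v : G, ((x * v : G) : G ⧸ T) ^ p = x ^ p * v ^ p) :
    ∃ K : Subgroup G, (∀ x, x ∈ K ↔ x ^ p ∈ T) ∧
      Nat.card K * Nat.card (powSubgroup (⊤ : Subgroup G) p) = Nat.card G * Nat.card T := by
  let f : G →* G ⧸ T :=
    { toFun := fun x => (x : G ⧸ T) ^ p
      map_one' := one_pow p
      map_mul' := hmul }
  have hrange : f.range = (powSubgroup ⊤ p).map (QuotientGroup.mk' T) := by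
    refine le_antisymm ?_ (map_le_iff_le_comap.2 (powSubgroup_le_iff.2 fun h _ => ⟨h, rfl⟩))
    rintro _ ⟨x, rfl⟩
    exact ⟨x ^ p, pow_mem_powSubgroup (mem_top x), rfl⟩
  refine ⟨f.ker, fun x => (QuotientGroup.eq_one_iff (x ^ p)), ?_⟩
  rw [← card_mul_index f.ker, index_ker, hrange, ← relIndex_ker, QuotientGroup.ker_mk',
    ← card_mul_relIndex_of_le hT]
  ring

theorem card_mul_card_inf_torsion {K N : Subgroup G} [N.Normal] (hNK : N ≤ K)
    (hK : ∀ x : G, x ^ p = 1 → x ∈ K) (h : ∀ x ∈ K, ∃ v ∈ N, (x * v) ^ p = 1) :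
    Nat.card K * Nat.card ↥(N ⊓ closure {x : G | x ^ p = 1}) =
      Nat.card N * Nat.card (closure {x : G | x ^ p = 1}) := by
  have : K = N ⊔ closure {x : G | x ^ p = 1} := by
    refine le_antisymm (fun x hx => ?_) (sup_le hNK ((closure_le _).2 hK))
    obtain ⟨v, hv, hxv⟩ := h x hx
    rw [← mul_inv_cancel_right x v]
    exact mul_mem (le_sup_right (a := N) (subset_closure hxv))
      (le_sup_left (a := N) (inv_mem hv))
  rw [this, card_sup_mul_card_inf]

/-- In a powerful `p`-group `|Ω₁(G)| = |G : G ^ p|`. -/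
theorem card_omega_mul_card_powSubgroup (hp : p.Prime) (hp5 : 5 ≤ p) {G : Type u} [Group G]
    [Finite G] (hG : IsPGroup p G)
    (hP : ⁅(⊤ : Subgroup G), (⊤ : Subgroup G)⁆ ≤ powSubgroup ⊤ p) :
    Nat.card (closure {x : G | x ^ p = 1}) * Nat.card (powSubgroup (⊤ : Subgroup G) p) =
      Nat.card G := by
  induction hn : Nat.card G using Nat.strong_induction_on generalizing G with
  | _ n ih =>
  subst hn
  have := isNilpotent_of_isPGroup hp hG
  by_cases hbot : (⊤ : Subgroup G) = ⊥
  · have hG1 : Nat.card G = 1 := by rw [← card_top, hbot, card_bot]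
    have h1 (H : Subgroup G) : Nat.card H = 1 :=
      Nat.dvd_one.1 (hG1 ▸ card_subgroup_dvd_card H)
    rw [h1, h1, hG1]
  have hlt := powSubgroup_lt_of_powerful hp hp5 hG hP hbot
  obtain ⟨P, hPdef⟩ : ∃ P : Subgroup G, P = powSubgroup ⊤ p := ⟨_, rfl⟩
  have hPn : P.Normal := hPdef ▸ inferInstance
  have hPE : ⁅P, (⊤ : Subgroup G)⁆ ≤ powSubgroup P p :=
    hPdef ▸ powSubgroup_powerfully_embedded hp hp5 hP
  have hPP : ⁅P, P⁆ ≤ powSubgroup P p := (commutator_mono le_rfl le_top).trans hPE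
  have ihP := ih _ (card_subgroup_lt (hPdef ▸ hlt.ne)) (hG.to_subgroup P) (powerful_subtype hPP) rfl
  have hA := (omegaRegular_of_powerful hp hp5 hG hP).1
  rw [card_powSubgroup_top_subtype, ← card_map_subtype, map_subtype_closure_torsion hA] at ihP
  obtain ⟨K, hK, hKcard⟩ := exists_powKer (T := powSubgroup P p) (powSubgroup_mono le_top)
    (hPdef ▸ mul_pow_congr_of_powerful hp hp5 hP)
  have hcount := card_mul_card_inf_torsion (p := p) (K := K) (N := P)
    (fun x hx => (hK x).2 (pow_mem_powSubgroup hx)) (fun x hx => (hK x).2 (hx ▸ one_mem _))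
    fun x hx => exists_mul_pow_eq_one hp hp5 hG hPP le_rfl (powSubgroup_le P) hPE
      (commutator_le_left _ _) ((hK x).1 hx)
  rw [← hPdef] at hKcard ⊢
  have h1 : 0 < Nat.card (powSubgroup P p) := Nat.card_pos
  have h2 : 0 < Nat.card P := Nat.card_pos
  refine Nat.eq_of_mul_eq_mul_right h1 ?_
  rw [← hKcard, mul_comm (Nat.card _) (Nat.card P), ← hcount, ← ihP]
  ring

end Counting

section CentralPairing

variable {p : ℕ} {Q : Type u} [Group Q]

theorem commutatorElement_mul_right_of_mem_center {f g h : Q} (hc : ⁅f, h⁆ ∈ center Q) :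
    ⁅f, g * h⁆ = ⁅f, g⁆ * ⁅f, h⁆ := by
  have := mem_center_iff.1 hc g
  rw [commutatorElement_mul_right_eq_mul_conj, mul_assoc, mul_assoc, ← mul_assoc g, this]
  simp

theorem commutatorElement_mul_left_of_mem_center {f g h : Q} (hc : ⁅g, h⁆ ∈ center Q) :
    ⁅f * g, h⁆ = ⁅f, h⁆ * ⁅g, h⁆ := by
  have h1 := mem_center_iff.1 hc f
  have h2 := mem_center_iff.1 hc ⁅f, h⁆
  rw [commutatorElement_mul_left_eq_conj_mul, h1, mul_inv_cancel_right, h2]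

/-- The Frattini-type subgroup generated by the `p`-th powers and the commutators of `H`. -/
def phi (p : ℕ) (H : Subgroup Q) : Subgroup Q := powSubgroup H p ⊔ ⁅H, H⁆

theorem powSubgroup_le_phi (H : Subgroup Q) : powSubgroup H p ≤ phi p H := le_sup_left

theorem commutator_le_phi (H : Subgroup Q) : ⁅H, H⁆ ≤ phi p H := le_sup_right

theorem phi_mono {H K : Subgroup Q} (h : H ≤ K) : phi p H ≤ phi p K :=
  sup_le_sup (powSubgroup_mono h) (commutator_mono h h)

instance phi_normal (H : Subgroup Q) [H.Normal] : (phi p H).Normal := by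
  unfold phi; infer_instance

theorem map_phi {G' : Type*} [Group G'] (f : Q →* G') (H : Subgroup Q) :
    (phi p H).map f = phi p (H.map f) := by
  rw [phi, phi, Subgroup.map_sup, map_powSubgroup, map_commutator]

theorem commutator_pow_eq_one_of_mem_center
    (hc : ⁅phi p (⊤ : Subgroup Q), (⊤ : Subgroup Q)⁆ ≤ center Q)
    (hp : powSubgroup (phi p (⊤ : Subgroup Q)) p = ⊥) {f : Q} (hf : f ∈ phi p (⊤ : Subgroup Q))
    (g : Q) : ⁅f, g⁆ ^ p = 1 := by
  have hpow {y : Q} (hy : y ∈ phi p (⊤ : Subgroup Q)) : y ^ p = 1 := by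
    rw [← mem_bot, ← hp]
    exact pow_mem_powSubgroup hy
  have hcen : ⁅f, g⁆ ∈ center Q := hc (commutator_mem_commutator hf (mem_top g))
  have hconj := conj_pow_eq_one (hpow (inv_mem hf)) g
  rw [conj_eq_mul_commutator, inv_inv,
    (show Commute f⁻¹ ⁅f, g⁆ from mem_center_iff.1 hcen _).mul_pow, hpow (inv_mem hf),
    one_mul] at hconj
  exact hconj

theorem phi_le_centralizer_phi
    (hc : ⁅phi p (⊤ : Subgroup Q), (⊤ : Subgroup Q)⁆ ≤ center Q)
    (hp : powSubgroup (phi p (⊤ : Subgroup Q)) p = ⊥) :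
    phi p (⊤ : Subgroup Q) ≤ centralizer (phi p (⊤ : Subgroup Q)) := by
  intro a ha
  rw [mem_centralizer_iff_commutator_eq_one]
  intro f hf
  have hcen (g : Q) : ⁅f, g⁆ ∈ center Q := hc (commutator_mem_commutator hf (mem_top g))
  let φ : Q →* center Q :=
    { toFun := fun g => ⟨⁅f, g⁆, hcen g⟩
      map_one' := Subtype.ext (commutatorElement_one_right f)
      map_mul' := fun g h => Subtype.ext (commutatorElement_mul_right_of_mem_center (hcen h)) }
  have hle : phi p (⊤ : Subgroup Q) ≤ φ.ker := by
    refine sup_le (powSubgroup_le_iff.2 fun g _ => ?_) (commutator_le.2 fun g _ h _ => ?_)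
    · rw [MonoidHom.mem_ker, map_pow]
      exact Subtype.ext (commutator_pow_eq_one_of_mem_center hc hp hf g)
    · rw [MonoidHom.mem_ker, map_commutatorElement, commutatorElement_eq_one_iff_commute]
      exact Subtype.ext (mem_center_iff.1 (φ h).2 (φ g))
  exact congrArg Subtype.val (hle ha)

theorem phi_centralizer_phi_le_center
    (hp : powSubgroup (phi p (⊤ : Subgroup Q)) p = ⊥) :
    phi p (centralizer (phi p (⊤ : Subgroup Q) : Set Q)) ≤ center Q := by
  set C := centralizer (phi p (⊤ : Subgroup Q) : Set Q)
  have hC : ⁅C, (⊤ : Subgroup Q)⁆ ≤ phi p ⊤ :=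
    (commutator_mono le_top le_rfl).trans (commutator_le_phi ⊤)
  have hbot : ⁅⁅C, (⊤ : Subgroup Q)⁆, C⁆ = ⊥ := by
    rw [← le_bot_iff]
    refine (commutator_mono hC le_rfl).trans (le_bot_iff.2 ?_)
    rw [commutator_comm]
    exact commutator_eq_bot_iff_le_centralizer.2 le_rfl
  refine sup_le (powSubgroup_le_iff.2 fun c hcC => mem_center_iff.2 fun g => ?_) ?_
  · have hu : ⁅c⁻¹, g⁆ ∈ phi p (⊤ : Subgroup Q) :=
      hC (commutator_mem_commutator (inv_mem hcC) (mem_top g))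
    have hup : ⁅c⁻¹, g⁆ ^ p = 1 := by
      rw [← mem_bot, ← hp]
      exact pow_mem_powSubgroup hu
    have hcu : Commute c ⁅c⁻¹, g⁆ := (mem_centralizer_iff.1 hcC _ hu).symm
    have := hcu.mul_pow p
    rwa [hup, mul_one, ← conj_eq_mul_commutator, conj_pow, mul_inv_eq_iff_eq_mul] at this
  · rw [← commutator_top_right_eq_bot_iff_le_center]
    exact commutator_commutator_eq_bot_of_rotate hbot (by rwa [commutator_comm ⊤ C])

theorem card_monoidHom_complex_le (A : Type*) [Monoid A] [Finite A] :
    Finite (A →* ℂ) ∧ Nat.card (A →* ℂ) ≤ Nat.card A := by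
  have := Fintype.ofFinite A
  have hli := linearIndependent_monoidHom A ℂ
  have hfin : Finite (A →* ℂ) := hli.finite
  have := Fintype.ofFinite (A →* ℂ)
  refine ⟨hfin, ?_⟩
  rw [Nat.card_eq_fintype_card, Nat.card_eq_fintype_card]
  exact hli.fintype_card_le_finrank.trans_eq (Module.finrank_fintype_fun_eq_card ℂ)

/-- The commutator pairing into a center with a faithful character bounds the index of a
centralizer. -/
theorem index_centralizer_le [Finite Q] {F : Subgroup Q}
    (hc : ⁅F, (⊤ : Subgroup Q)⁆ ≤ center Q) {χ : center Q →* ℂˣ} (hχ : Function.Injective χ) :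
    (centralizer (F : Set Q)).index ≤ (center Q).relIndex F := by
  have hcen (f : F) (g : Q) : ⁅(f : Q), g⁆ ∈ center Q :=
    hc (commutator_mem_commutator f.2 (mem_top g))
  let ψ (g : Q) : F →* ℂˣ :=
    { toFun := fun f => χ ⟨⁅(f : Q), g⁆, hcen f g⟩
      map_one' := by
        rw [← map_one χ]
        exact congrArg χ (Subtype.ext (commutatorElement_one_left g))
      map_mul' := fun a b => by
        rw [← map_mul χ]
        exact congrArg χ (Subtype.ext (commutatorElement_mul_left_of_mem_center (hcen b g))) }
  have hψ (g : Q) : (center Q).subgroupOf F ≤ (ψ g).ker := by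
    intro f hf
    rw [MonoidHom.mem_ker, ← map_one χ]
    refine congrArg χ (Subtype.ext (commutatorElement_eq_one_iff_commute.2 ?_))
    exact (mem_center_iff.1 (mem_subgroupOf.1 hf) g).symm
  let Ψ (g : Q) : F ⧸ (center Q).subgroupOf F →* ℂ :=
    (Units.coeHom ℂ).comp (QuotientGroup.lift _ (ψ g) (hψ g))
  have hΨ {g h : Q} (hgh : Ψ g = Ψ h) : g⁻¹ * h ∈ centralizer (F : Set Q) := by
    rw [mem_centralizer_iff_commutator_eq_one]
    intro f hf
    have h1 : (ψ g ⟨f, hf⟩ : ℂ) = ψ h ⟨f, hf⟩ :=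
      DFunLike.congr_fun hgh ((⟨f, hf⟩ : F) : F ⧸ (center Q).subgroupOf F)
    have h2 : ⁅f, g⁆ = ⁅f, h⁆ := congrArg Subtype.val (hχ (Units.ext h1))
    have h3 := commutatorElement_mul_right_of_mem_center (g := g) (hcen ⟨f, hf⟩ (g⁻¹ * h))
    rw [mul_inv_cancel_left, h2] at h3
    exact (mul_eq_left.1 h3.symm)
  obtain ⟨hfin, hle⟩ := card_monoidHom_complex_le (F ⧸ (center Q).subgroupOf F)
  rw [index_eq_card, relIndex, index_eq_card]
  refine le_trans (Nat.card_le_card_of_injective (fun q => Ψ q.out) fun a b hab => ?_) hle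
  rw [← QuotientGroup.out_eq' a, ← QuotientGroup.out_eq' b]
  exact QuotientGroup.eq.2 (hΨ hab)

end CentralPairing

section LargeCentralizer

variable {p : ℕ} {G : Type u} [Group G] [Finite G]

theorem exists_injective_character_center {y : G} (hy : y ∈ center G)
    (h : ∀ N : Subgroup G, N.Normal → N ≠ ⊥ → y ∈ N) (hy1 : y ≠ 1) :
    ∃ χ : center G →* ℂˣ, Function.Injective χ := by
  let _ : CommGroup (center G) :=
    { mul_comm := fun a b => Subtype.ext (mem_center_iff.1 b.2 a) }
  obtain ⟨χ, hχ⟩ := CommGroup.exists_apply_ne_one_of_hasEnoughRootsOfUnity (center G) ℂ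
    (a := ⟨y, hy⟩) (fun h => hy1 (congrArg Subtype.val h))
  refine ⟨χ, (MonoidHom.ker_eq_bot_iff χ).1 ?_⟩
  by_contra hker
  have hmem := h (χ.ker.map (center G).subtype) ⟨fun n hn g => ?_⟩
    fun h => hker ((map_eq_bot_iff_of_injective _ (center G).subtype_injective).1 h)
  · obtain ⟨z, hz, hzy⟩ := hmem
    exact hχ ((congrArg χ (Subtype.ext hzy.symm)).trans hz)
  · obtain ⟨z, -, rfl⟩ := id hn
    have : g * (center G).subtype z * g⁻¹ = (center G).subtype z := by
      rw [mul_inv_eq_iff_eq_mul]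
      exact mem_center_iff.1 z.2 g
    rwa [this]

/-- If `[Φ(G), G]` is not contained in `Φ(G) ^ p`, then `G` has a proper normal subgroup `C`
containing `Φ(G)` for which `|G : C| ≤ |Φ(G) : F|`, where `F` contains `Φ(C)` and `[Φ(G), G]`. -/
theorem exists_centralizer_of_not_le (hp : p.Prime) (hG : IsPGroup p G)
    (h : ¬ ⁅phi p (⊤ : Subgroup G), (⊤ : Subgroup G)⁆ ≤ powSubgroup (phi p ⊤) p) :
    ∃ C F : Subgroup G, C.Normal ∧ C ≠ ⊤ ∧ phi p ⊤ ≤ C ∧ phi p C ≤ F ∧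
      ⁅phi p (⊤ : Subgroup G), (⊤ : Subgroup G)⁆ ≤ F ∧
      Nat.card G * Nat.card F ≤ Nat.card (phi p (⊤ : Subgroup G)) * Nat.card C := by
  have := isNilpotent_of_isPGroup hp hG
  obtain ⟨L, hLe, ⟨hLn, hL⟩, hmax⟩ := Finite.exists_le_maximal
    (p := fun L : Subgroup G => L.Normal ∧ ¬ ⁅phi p (⊤ : Subgroup G), (⊤ : Subgroup G)⁆ ≤ L)
    ⟨inferInstance, h⟩
  have hbig {N : Subgroup G} (hN : N.Normal) (hLN : L ≤ N) (hne : ¬ N ≤ L) :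
      ⁅phi p (⊤ : Subgroup G), (⊤ : Subgroup G)⁆ ≤ N :=
    not_not.1 fun h' => hne (hmax ⟨hN, h'⟩ hLN)
  have hcomm : ⁅⁅phi p (⊤ : Subgroup G), (⊤ : Subgroup G)⁆, (⊤ : Subgroup G)⁆ ≤ L := by
    by_contra hc
    refine hL (le_of_le_sup_commutator (hbig inferInstance le_sup_left fun h' => hc ?_))
    exact le_sup_right.trans h'
  have hsurj := QuotientGroup.mk'_surjective L
  have hmap : (phi p (⊤ : Subgroup G)).map (QuotientGroup.mk' L) = phi p ⊤ := by
    rw [map_phi, map_top_of_surjective _ hsurj]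
  have hmapc : ⁅phi p (⊤ : Subgroup G), (⊤ : Subgroup G)⁆.map (QuotientGroup.mk' L) =
      ⁅phi p (⊤ : Subgroup (G ⧸ L)), (⊤ : Subgroup (G ⧸ L))⁆ := by
    rw [map_commutator, hmap, map_top_of_surjective _ hsurj]
  have hcen : ⁅phi p (⊤ : Subgroup (G ⧸ L)), (⊤ : Subgroup (G ⧸ L))⁆ ≤ center (G ⧸ L) := by
    rw [← hmapc, map_le_iff_le_comap]
    exact commutator_top_le_iff.1 hcomm
  have hpow : powSubgroup (phi p (⊤ : Subgroup (G ⧸ L))) p = ⊥ := by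
    rw [← hmap, ← map_powSubgroup, ← le_bot_iff, map_le_iff_le_comap, MonoidHom.comap_bot,
      QuotientGroup.ker_mk']
    exact hLe
  have hne : ⁅phi p (⊤ : Subgroup (G ⧸ L)), (⊤ : Subgroup (G ⧸ L))⁆ ≠ ⊥ := by
    rw [← hmapc, Ne, ← le_bot_iff, map_le_iff_le_comap, MonoidHom.comap_bot,
      QuotientGroup.ker_mk']
    exact hL
  obtain ⟨⟨y, hy⟩, hy1⟩ := ne_bot_iff_exists_ne_one.1 hne
  have hymem (N : Subgroup (G ⧸ L)) (hN : N.Normal) (hNb : N ≠ ⊥) : y ∈ N := by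
    refine (hmapc.symm.trans_le (map_le_iff_le_comap.2 (hbig (hN.comap _) ?_ fun h' => hNb ?_))) hy
    · exact (QuotientGroup.ker_mk' L).symm.trans_le (MonoidHom.ker_le_comap _ N)
    · rw [← map_comap_eq_self_of_surjective hsurj N, ← le_bot_iff, map_le_iff_le_comap,
        MonoidHom.comap_bot, QuotientGroup.ker_mk']
      exact h'
  obtain ⟨χ, hχ⟩ := exists_injective_character_center (hcen hy) hymem
    fun h => hy1 (Subtype.ext h)
  have hindex := index_centralizer_le hcen hχ
  set D := centralizer (phi p (⊤ : Subgroup (G ⧸ L)) : Set (G ⧸ L)) with hD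
  rw [← hmap, ← relIndex_comap, ← inf_relIndex_left,
    ← index_comap_of_surjective D hsurj] at hindex
  refine ⟨D.comap (QuotientGroup.mk' L),
    phi p ⊤ ⊓ (center (G ⧸ L)).comap (QuotientGroup.mk' L), inferInstance, fun htop => hne ?_,
    ?_, le_inf (phi_mono le_top) ?_, le_inf (commutator_le_left _ _) ?_, ?_⟩
  · rw [commutator_comm]
    refine commutator_eq_bot_iff_le_centralizer.2 ?_
    rw [← hD, ← map_comap_eq_self_of_surjective hsurj D, htop, map_top_of_surjective _ hsurj]
  · rw [← map_le_iff_le_comap, hmap]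
    exact phi_le_centralizer_phi hcen hpow
  · rw [← map_le_iff_le_comap, map_phi, map_comap_eq_self_of_surjective hsurj]
    exact phi_centralizer_phi_le_center hpow
  · exact commutator_top_le_iff.1 hcomm
  · rw [← card_mul_index (D.comap (QuotientGroup.mk' L)), ← card_mul_relIndex_of_le
      (inf_le_left (a := phi p ⊤) (b := (center (G ⧸ L)).comap (QuotientGroup.mk' L)))]
    calc _ = Nat.card (D.comap (QuotientGroup.mk' L)) * Nat.card
          (phi p ⊤ ⊓ (center (G ⧸ L)).comap (QuotientGroup.mk' L) : Subgroup G) *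
          (D.comap (QuotientGroup.mk' L)).index := by ring
      _ ≤ _ := Nat.mul_le_mul_left _ hindex
      _ = _ := by ring

end LargeCentralizer

section Main

variable {p : ℕ} {G : Type u} [Group G]

theorem phi_eq_powSubgroup {H : Subgroup G} (h : ⁅H, H⁆ ≤ powSubgroup H p) :
    phi p H = powSubgroup H p :=
  sup_eq_left.2 h

theorem card_phi_top_subtype (H : Subgroup G) :
    Nat.card (phi p (⊤ : Subgroup H)) = Nat.card (phi p H) := by
  rw [← card_map_subtype, map_phi, map_subtype_top]

variable [Finite G]

theorem powerful_of_card_phi_le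
    (h : Nat.card (phi p (⊤ : Subgroup G)) ≤ Nat.card (powSubgroup (⊤ : Subgroup G) p)) :
    ⁅(⊤ : Subgroup G), (⊤ : Subgroup G)⁆ ≤ powSubgroup ⊤ p :=
  (commutator_le_phi ⊤).trans_eq (eq_of_le_of_card_ge (powSubgroup_le_phi ⊤) h).symm

theorem card_closure_torsion_subtype_le (H : Subgroup G) :
    Nat.card (closure {x : H | x ^ p = 1}) ≤
      Nat.card (H ⊓ closure {x : G | x ^ p = 1} : Subgroup G) := by
  rw [← card_map_subtype]
  exact card_le_of_le (map_subtype_closure_torsion_le H)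

theorem card_le_of_commutator_phi_le (hp : p.Prime) (hp5 : 5 ≤ p) (hG : IsPGroup p G)
    (h : ⁅phi p (⊤ : Subgroup G), (⊤ : Subgroup G)⁆ ≤ powSubgroup (phi p ⊤) p) :
    Nat.card G ≤
      Nat.card (closure {x : G | x ^ p = 1}) * Nat.card (powSubgroup (⊤ : Subgroup G) p) := by
  have hP : ⁅phi p (⊤ : Subgroup G), phi p (⊤ : Subgroup G)⁆ ≤ powSubgroup (phi p ⊤) p :=
    (commutator_mono le_rfl le_top).trans h
  obtain ⟨K, hK, hKcard⟩ := exists_powKer (powSubgroup_mono le_top) fun x v =>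
    mul_pow_congr hp hp5 (commutator_le_phi ⊤ (commutator_mem_commutator (mem_top v⁻¹)
      (mem_top x⁻¹))) h (commutator_le_left _ _) le_rfl (powSubgroup_le (phi p ⊤))
  have hNcard := card_mul_card_inf_torsion (p := p) (K := K) (N := phi p (⊤ : Subgroup G))
    (fun x hx => (hK x).2 (pow_mem_powSubgroup hx)) (fun x hx => (hK x).2 (hx ▸ one_mem _))
    fun x hx => exists_mul_pow_eq_one hp hp5 hG hP le_rfl (powSubgroup_le _) h
      (commutator_le_left _ _) ((hK x).1 hx)
  have hΦ := card_omega_mul_card_powSubgroup hp hp5 (hG.to_subgroup _) (powerful_subtype hP)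
  rw [card_powSubgroup_top_subtype] at hΦ
  have hle := card_closure_torsion_subtype_le (p := p) (phi p (⊤ : Subgroup G))
  have hpos : 0 < Nat.card (powSubgroup (phi p (⊤ : Subgroup G)) p) *
      Nat.card (phi p ⊤ ⊓ closure {x : G | x ^ p = 1} : Subgroup G) :=
    Nat.mul_pos Nat.card_pos Nat.card_pos
  refine Nat.le_of_mul_le_mul_right ?_ hpos
  rw [← mul_assoc, ← hKcard, mul_right_comm, hNcard, ← hΦ]
  calc _ = Nat.card (closure {x : phi p (⊤ : Subgroup G) | x ^ p = 1}) *
        (Nat.card (powSubgroup (phi p (⊤ : Subgroup G)) p) *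
          Nat.card (closure {x : G | x ^ p = 1}) *
          Nat.card (powSubgroup (⊤ : Subgroup G) p)) := by ring
    _ ≤ _ := Nat.mul_le_mul_right _ hle
    _ = _ := by ring

theorem card_phi_le_of_powerful_subgroup (hp : p.Prime) (hp5 : 5 ≤ p) (hG : IsPGroup p G)
    {C : Subgroup G} [C.Normal] (hC : ⁅C, C⁆ ≤ powSubgroup C p) (hΦC : phi p ⊤ ≤ C)
    (hΦ : ⁅phi p (⊤ : Subgroup G), (⊤ : Subgroup G)⁆ ≤ powSubgroup C p)
    (hΩ : closure {x : G | x ^ p = 1} ≤ C)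
    (hcard : Nat.card (phi p (⊤ : Subgroup G)) * Nat.card C ≤
      Nat.card G * Nat.card (powSubgroup C p)) :
    Nat.card (phi p (⊤ : Subgroup G)) ≤ Nat.card (powSubgroup (⊤ : Subgroup G) p) := by
  have hCΦ : powSubgroup C p ≤ phi p ⊤ := (powSubgroup_mono le_top).trans (powSubgroup_le_phi ⊤)
  obtain ⟨K, hK, hKcard⟩ := exists_powKer (powSubgroup_mono le_top) fun x v =>
    mul_pow_congr hp hp5 (commutator_le_phi ⊤ (commutator_mem_commutator (mem_top v⁻¹)
      (mem_top x⁻¹))) hΦ (commutator_le_left _ _) (powSubgroup_mono hΦC) hCΦ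
  have hKC : K ≤ C := fun x hx => by
    obtain ⟨v, hv, hxv⟩ := exists_mul_pow_eq_one hp hp5 hG hC hCΦ hΦC
      ((commutator_mono le_top le_rfl).trans (commutator_le_phi ⊤)) hΦ ((hK x).1 hx)
    exact (mul_mem_cancel_right hv).1 (hΩ (subset_closure hxv))
  refine Nat.le_of_mul_le_mul_right (c := Nat.card C) ?_ Nat.card_pos
  calc _ ≤ Nat.card K * Nat.card (powSubgroup (⊤ : Subgroup G) p) := hKcard ▸ hcard
    _ ≤ Nat.card C * Nat.card (powSubgroup (⊤ : Subgroup G) p) :=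
      Nat.mul_le_mul_right _ (card_le_of_le hKC)
    _ = _ := mul_comm _ _

/-- `|G : Φ(G)| ≤ |Ω₁(G)|`, and equality forces `G` to be powerful. -/
theorem card_le_card_omega_mul_card_phi (hp : p.Prime) (hp5 : 5 ≤ p) (hG : IsPGroup p G) :
    Nat.card G ≤ Nat.card (closure {x : G | x ^ p = 1}) * Nat.card (phi p (⊤ : Subgroup G)) ∧
      (Nat.card (closure {x : G | x ^ p = 1}) * Nat.card (phi p (⊤ : Subgroup G)) ≤ Nat.card G →
        ⁅(⊤ : Subgroup G), (⊤ : Subgroup G)⁆ ≤ powSubgroup ⊤ p) := by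
  induction hn : Nat.card G using Nat.strong_induction_on generalizing G with
  | _ n ih =>
  subst hn
  by_cases h : ⁅phi p (⊤ : Subgroup G), (⊤ : Subgroup G)⁆ ≤ powSubgroup (phi p ⊤) p
  · have hle := card_le_of_commutator_phi_le hp hp5 hG h
    refine ⟨hle.trans (Nat.mul_le_mul_left _ (card_le_of_le (powSubgroup_le_phi ⊤))),
      fun heq => powerful_of_card_phi_le ?_⟩
    exact Nat.le_of_mul_le_mul_left (heq.trans hle) Nat.card_pos
  · obtain ⟨C, F, hCn, hCtop, hΦC, hCF, hΦF, hcard⟩ := exists_centralizer_of_not_le hp hG h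
    obtain ⟨hle, hpow⟩ := ih _ (card_subgroup_lt hCtop) (hG.to_subgroup C) rfl
    rw [card_phi_top_subtype] at hle hpow
    have h1 := card_closure_torsion_subtype_le (p := p) C
    have h2 : Nat.card (C ⊓ closure {x : G | x ^ p = 1} : Subgroup G) ≤
      Nat.card (closure {x : G | x ^ p = 1}) := card_le_of_le inf_le_right
    have h3 : Nat.card (phi p C) ≤ Nat.card F := card_le_of_le hCF
    have hCle := hle.trans (Nat.mul_le_mul (h1.trans h2) h3)
    have hF : 0 < Nat.card F := Nat.card_pos
    have hΦ : 0 < Nat.card (phi p (⊤ : Subgroup G)) := Nat.card_pos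
    refine ⟨Nat.le_of_mul_le_mul_right (c := Nat.card F) ?_ hF, fun heq => ?_⟩
    · calc _ ≤ _ := hcard
        _ ≤ _ := Nat.mul_le_mul_left _ hCle
        _ = _ := by ring
    have hCge : Nat.card (closure {x : G | x ^ p = 1}) * Nat.card F ≤ Nat.card C := by
      refine Nat.le_of_mul_le_mul_left (c := Nat.card (phi p (⊤ : Subgroup G))) ?_ hΦ
      calc _ = _ := by ring
        _ ≤ _ := (Nat.mul_le_mul_right _ heq).trans hcard
    have hge := hCge.trans (hle.trans (Nat.mul_le_mul_right _ h1))
    have hC : ⁅C, C⁆ ≤ powSubgroup C p := by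
      have := map_mono (f := C.subtype)
        (hpow ((Nat.mul_le_mul (h1.trans h2) h3).trans hCge))
      rwa [map_commutator, map_subtype_top, map_subtype_powSubgroup_top] at this
    have hΩ : closure {x : G | x ^ p = 1} ≤ C := by
      refine inf_eq_right.1 (eq_of_le_of_card_ge inf_le_right ?_)
      exact Nat.le_of_mul_le_mul_right (hge.trans (Nat.mul_le_mul_left _ h3)) hF
    have hFC : F = powSubgroup C p := by
      rw [← phi_eq_powSubgroup hC]
      refine (eq_of_le_of_card_ge hCF ?_).symm
      exact Nat.le_of_mul_le_mul_left (hge.trans (Nat.mul_le_mul_right _ h2)) Nat.card_pos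
    subst hFC
    refine powerful_of_card_phi_le
      (card_phi_le_of_powerful_subgroup hp hp5 hG hC hΦC hΦF hΩ ?_)
    calc _ ≤ _ := Nat.mul_le_mul_left _ hCle
      _ = _ := by ring
      _ ≤ _ := Nat.mul_le_mul_right _ heq

end Main

section Rank

variable {p : ℕ} {G : Type u} [Group G]

theorem pow_rank_le_card_of_pow_eq_one {V : Type u} [CommGroup V] [Finite V] (hp : p.Prime)
    (h : ∀ v : V, v ^ p = 1) : p ^ Group.rank V ≤ Nat.card V := by
  have : Fact p.Prime := ⟨hp⟩
  classical
  obtain ⟨_⟩ : Nonempty (Module (ZMod p) (Additive V)) :=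
    ⟨AddCommGroup.zmodModule fun v => h v.toMul⟩
  have : Module.Finite (ZMod p) (Additive V) := Module.Finite.of_finite
  let b := Module.finBasis (ZMod p) (Additive V)
  let S : Finset V := Finset.univ.image fun i => (b i).toMul
  have hcl : closure (S : Set V) = ⊤ := by
    refine eq_top_iff.2 fun v _ => ?_
    have hspan : Submodule.span (ZMod p) (Set.range b) ≤ AddSubgroup.toZModSubmodule p
        (closure (S : Set V)).toAddSubgroup := by
      refine Submodule.span_le.2 ?_
      rintro _ ⟨i, rfl⟩
      exact Subgroup.subset_closure (k := (S : Set V))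
        (Finset.mem_coe.2 (Finset.mem_image_of_mem _ (Finset.mem_univ i)))
    rw [b.span_eq] at hspan
    exact hspan (Submodule.mem_top (x := Additive.ofMul v))
  have hcard : Nat.card V = p ^ Module.finrank (ZMod p) (Additive V) := by
    have := Module.natCard_eq_pow_finrank (K := ZMod p) (V := Additive V)
    rwa [Nat.card_zmod] at this
  rw [hcard]
  refine Nat.pow_le_pow_right hp.pos ((Group.rank_le hcl).trans (Finset.card_image_le.trans ?_))
  rw [Finset.card_univ, Fintype.card_fin]

theorem rank_quotient_phi [Finite G] (hp : p.Prime) (hG : IsPGroup p G) :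
    Group.rank (G ⧸ phi p (⊤ : Subgroup G)) = Group.rank G := by
  classical
  have hsurj := QuotientGroup.mk'_surjective (phi p (⊤ : Subgroup G))
  refine le_antisymm (Group.rank_le_of_surjective _ hsurj) ?_
  obtain ⟨S, hScard, hS⟩ := Group.rank_spec (G ⧸ phi p (⊤ : Subgroup G))
  rw [← hScard]
  refine (Group.rank_le (S := S.image Quotient.out) ?_).trans Finset.card_image_le
  refine eq_top_of_sup_frattini_eq_top hp hG ?_
  have hmap : (closure ((S.image Quotient.out : Finset G) : Set G)).map
      (QuotientGroup.mk' (phi p (⊤ : Subgroup G))) = ⊤ := by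
    rw [eq_top_iff, ← hS, closure_le]
    exact fun q hq => ⟨q.out, subset_closure (Finset.mem_coe.2 (Finset.mem_image_of_mem _ hq)),
      QuotientGroup.out_eq' q⟩
  have := congrArg (comap (QuotientGroup.mk' (phi p (⊤ : Subgroup G)))) hmap
  rwa [comap_map_eq, QuotientGroup.ker_mk', comap_top] at this

/-- The Burnside basis theorem in the form `p ^ d(G) = |G : Φ(G)|`. -/
theorem pow_rank_mul_card_phi [Finite G] (hp : p.Prime) (hG : IsPGroup p G) :
    p ^ Group.rank G * Nat.card (phi p (⊤ : Subgroup G)) = Nat.card G := by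
  let _ : CommGroup (G ⧸ phi p (⊤ : Subgroup G)) :=
    { mul_comm := by
        rintro ⟨a⟩ b
        exact commute_mk_of_commutator_le (commutator_le_phi ⊤) (mem_top a) b }
  have hpow (v : G ⧸ phi p (⊤ : Subgroup G)) : v ^ p = 1 := by
    obtain ⟨a, rfl⟩ := QuotientGroup.mk_surjective v
    rw [← QuotientGroup.mk_pow, QuotientGroup.eq_one_iff]
    exact powSubgroup_le_phi ⊤ (pow_mem_powSubgroup (mem_top a))
  have hcard : p ^ Group.rank (G ⧸ phi p (⊤ : Subgroup G)) =
      Nat.card (G ⧸ phi p (⊤ : Subgroup G)) :=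
    le_antisymm (pow_rank_le_card_of_pow_eq_one hp hpow)
      (Nat.le_of_dvd (pow_pos hp.pos _) (card_dvd_exponent_pow_rank' _ hpow))
  rw [← rank_quotient_phi hp hG, hcard, ← index_eq_card, index_mul_card]

end Rank

end Powerful

/-- **Theorem A.** For `p ≥ 5` and a finite `p`-group `G`, `G` is powerful iff
`d(G) = log_p |Ω₁(G)|`, i.e. `p ^ d(G) = |Ω₁(G)|`. -/
theorem powerful_iff_rank_eq_log_card_omega {G : Type*} [Group G] [Finite G] {p : ℕ}
    (hp : p.Prime) (hp5 : 5 ≤ p) (hG : IsPGroup p G) :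
    commutator G ≤ powSubgroup (⊤ : Subgroup G) p ↔
      p ^ Group.rank G = Nat.card (Subgroup.closure {g : G | g ^ p = 1}) := by
  have hrank := pow_rank_mul_card_phi hp hG
  constructor
  · intro h
    have hΩ := card_omega_mul_card_powSubgroup hp hp5 hG h
    rw [phi_eq_powSubgroup h, ← hΩ] at hrank
    exact Nat.eq_of_mul_eq_mul_right Nat.card_pos hrank
  · intro h
    rw [h] at hrank
    exact (card_le_card_omega_mul_card_phi hp hp5 hG).2 hrank.le
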